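/- arXiv:2502.00303 — 3 statements merged into one kernel-verified Lean document; each statement's English description precedes it below -/
import Mathlib

section
/- Suppose Q is a Dirac potential on [−b,b] with continuously differentiable entries, and K : Ω → M₂ is continuously differentiable on Ω := {(x,t) : |t| ≤ |x| ≤ b} and satisfies B·∂ₓK(x,t) + ∂ₜK(x,t)·B = −Q(x)·K(x,t) on Ω together with the Goursat conditions B·K(x,x) − K(x,x)·B = −Q(x) and B·K(x,−x) + K(x,−x)·B = 0. Define, for continuous Y : [−b,b] → ℂ², the operator (T Y)(x) := Y(x) + ∫_{−x}^{x} K(x,t)·Y(t) dt. Then for every continuously differentiable Y : [−b,b] → ℂ² and every x ∈ [−b,b], B·(T Y)′(x) + Q(x)·(T Y)(x) = B·Y′(x) + ∫_{−x}^{x} K(x,t)·B·Y′(t) dt; that is, T is a transmutation operator intertwining A_Q := B·d/dx + Q and A₀ := B·d/dx on C¹ functions. -/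
noncomputable section

open MeasureTheory Set Filter Topology Polynomial intervalIntegral

abbrev M2 : Type := Matrix (Fin 2) (Fin 2) ℂ

attribute [local instance] Matrix.normedAddCommGroup Matrix.normedSpace

/-- The matrix `B` of the Dirac system. -/
def Bmat : M2 := !![0, 1; -1, 0]

/-- The Dirac potential built from the scalar functions `p, q`. -/
def diracPot (p q : ℝ → ℂ) : ℝ → M2 := fun x => !![p x, q x; q x, -p x]

/-- Operator norm of a `2 × 2` complex matrix, induced by the Euclidean norm on `ℂ²`. -/
def opNorm (A : M2) : ℝ := ‖Matrix.toEuclideanCLM (𝕜 := ℂ) A‖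

/-- The Legendre polynomial of degree `n` (Rodrigues' formula). -/
def legendreP (n : ℕ) : Polynomial ℝ :=
  ((2 ^ n * n.factorial : ℝ)⁻¹) • (fun r => derivative r)^[n] ((X ^ 2 - 1 : Polynomial ℝ) ^ n)

/-- The domain `Ω⁺ = {(x,t) : 0 ≤ x ≤ b, |t| ≤ x}`. -/
def OmegaPlus (b : ℝ) : Set (ℝ × ℝ) := {z | 0 ≤ z.1 ∧ z.1 ≤ b ∧ |z.2| ≤ z.1}

/-- `K` is a transmutation kernel for the potential `Q` on `Ω⁺`: it satisfies the
hyperbolic PDE `B⬝∂ₓK + ∂ₜK⬝B = -Q⬝K` together with the two Goursat conditions. -/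
def IsTransKernel (b : ℝ) (Q : ℝ → M2) (K : ℝ → ℝ → M2) : Prop :=
  (∀ x t : ℝ, (x, t) ∈ OmegaPlus b →
      Bmat * deriv (fun s => K s t) x + deriv (fun s => K x s) t * Bmat = -(Q x * K x t)) ∧
  (∀ x ∈ Set.Icc (0 : ℝ) b, Bmat * K x x - K x x * Bmat = -Q x) ∧
  (∀ x ∈ Set.Icc (0 : ℝ) b, Bmat * K x (-x) + K x (-x) * Bmat = 0)

/-- The `n`-th Fourier–Legendre coefficient `K_n(x)` of the kernel `K`. -/
def Kcoef (K : ℝ → ℝ → M2) (n : ℕ) (x : ℝ) : M2 :=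
  ((2 * (n : ℝ) + 1) / 2) • ∫ t in (-x)..x, ((legendreP n).eval (t / x)) • K x t

/-- The truncated kernel `K^N(x,t) = Σ_{n=0}^{N} (1/x)·K_n(x)·P_n(t/x)`. -/
def KN (K : ℝ → ℝ → M2) (N : ℕ) (x t : ℝ) : M2 :=
  ∑ n ∈ Finset.range (N + 1), (x⁻¹ * (legendreP n).eval (t / x)) • Kcoef K n x

/-- The free solution `U₀(λ,x)`. -/
def U0 (lam : ℂ) (x : ℝ) : M2 :=
  !![Complex.cos (lam * x), -Complex.sin (lam * x);
     Complex.sin (lam * x), Complex.cos (lam * x)]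

/-- `U(λ,x) = U₀(λ,x) + ∫_{-x}^{x} K(x,t)·U₀(λ,t) dt`. -/
def Umat (K : ℝ → ℝ → M2) (lam : ℂ) (x : ℝ) : M2 :=
  U0 lam x + ∫ t in (-x)..x, K x t * U0 lam t

/-- `U^N(λ,x) = U₀(λ,x) + ∫_{-x}^{x} K^N(x,t)·U₀(λ,t) dt`. -/
def UmatN (K : ℝ → ℝ → M2) (N : ℕ) (lam : ℂ) (x : ℝ) : M2 :=
  U0 lam x + ∫ t in (-x)..x, KN K N x t * U0 lam t

/-- `θ_n(x) = xⁿ·K_n(x)` for `n ≥ 0`, and `θ_{-1}(x) = -K₀(x)/x`. -/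
def theta (K : ℝ → ℝ → M2) (n : ℤ) : ℝ → M2 := fun x =>
  if n = -1 then -(x⁻¹ • Kcoef K 0 x) else (x ^ n.toNat : ℝ) • Kcoef K n.toNat x

/-- The integral operator `S[H](x) = U(x)·∫₀ˣ U(t)⁻¹·Bᵀ·H(t) dt`, where `U = U(0,·)`. -/
def Sop (U : ℝ → M2) (H : ℝ → M2) (x : ℝ) : M2 :=
  U x * ∫ t in (0 : ℝ)..x, (U t)⁻¹ * Bmat.transpose * H t



section helpers

theorem ftc_within {E : Type*} [NormedAddCommGroup E] [NormedSpace ℝ E] [CompleteSpace E]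
    {a b : ℝ} (hab : a ≤ b) {f f' : ℝ → E}
    (hf : ∀ x ∈ Icc a b, HasDerivWithinAt f (f' x) (Icc a b) x)
    (hc : ContinuousOn f' (Icc a b)) : ∫ y in a..b, f' y = f b - f a := by
  refine integral_eq_sub_of_hasDerivAt_of_le hab (fun x hx => (hf x hx).continuousWithinAt)
    (fun x hx => (hf x (Ioo_subset_Icc_self hx)).hasDerivAt (Icc_mem_nhds hx.1 hx.2)) ?_
  exact ContinuousOn.intervalIntegrable (by rwa [uIcc_of_le hab])

theorem param_deriv {E : Type*} [NormedAddCommGroup E] [NormedSpace ℝ E] [CompleteSpace E]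
    {a b c d : ℝ} (hab : a ≤ b) (hcd : c ≤ d) {F g : ℝ → ℝ → E}
    (hg : ContinuousOn (fun z : ℝ × ℝ => g z.1 z.2) (Icc a b ×ˢ Icc c d))
    (hF : ∀ s ∈ Icc c d, ∀ x ∈ Icc a b, HasDerivWithinAt (fun x => F x s) (g x s) (Icc a b) x)
    (hFi : ∀ x ∈ Icc a b, IntervalIntegrable (F x) volume c d)
    (x : ℝ) (hx : x ∈ Icc a b) :
    HasDerivWithinAt (fun x => ∫ s in c..d, F x s) (∫ s in c..d, g x s) (Icc a b) x := by
  set G : ℝ → ℝ → E := fun x s => g (projIcc a b hab x) (projIcc c d hcd s) with hG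
  have hGc : Continuous (fun z : ℝ × ℝ => G z.1 z.2) := by
    have := hg.comp_continuous (f := fun z : ℝ × ℝ =>
      (((projIcc a b hab z.1 : ℝ)), ((projIcc c d hcd z.2 : ℝ)))) (by fun_prop)
      (fun z => ⟨(projIcc a b hab z.1).2, (projIcc c d hcd z.2).2⟩)
    exact this
  have hGe : ∀ x ∈ Icc a b, ∀ s ∈ Icc c d, G x s = g x s := by
    intro x hx s hs
    simp [hG, projIcc_of_mem hab hx, projIcc_of_mem hcd hs]
  have hI : Continuous (fun y => ∫ s in c..d, G y s) :=
    continuous_parametric_intervalIntegral_of_continuous' (f := G) hGc c d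
  have key : ∀ x ∈ Icc a b, ∫ s in c..d, F x s
      = (∫ s in c..d, F a s) + ∫ y in a..x, ∫ s in c..d, G y s := by
    intro x hx
    rw [intervalIntegral_intervalIntegral_swap]
    · rw [← sub_eq_iff_eq_add', ← intervalIntegral.integral_sub (hFi x hx) (hFi a ⟨le_rfl, hab⟩)]
      refine intervalIntegral.integral_congr fun s hs => ?_
      rw [uIcc_of_le hcd] at hs
      have hsub : Icc a x ⊆ Icc a b := Icc_subset_Icc_right hx.2
      symm
      refine ftc_within (f := fun x => F x s) hx.1 (fun y hy => ?_) ?_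
      · have := (hF s hs y (hsub hy)).mono hsub
        simpa only [hGe y (hsub hy) s hs] using this
      · exact (hGc.comp (Continuous.prodMk_left s)).continuousOn
    · have : IntegrableOn (Function.uncurry G) (uIcc a x ×ˢ uIcc c d) :=
        ContinuousOn.integrableOn_compact (isCompact_uIcc.prod isCompact_uIcc)
          (Continuous.continuousOn hGc)
      exact this.mono_set (prod_mono uIoc_subset_uIcc uIoc_subset_uIcc)
  have e : ∫ s in c..d, g x s = ∫ s in c..d, G x s := by
    refine intervalIntegral.integral_congr fun s hs => ?_
    rw [uIcc_of_le hcd] at hs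
    exact (hGe x hx s hs).symm
  rw [e]
  have h1 : HasDerivAt (fun x => (∫ s in c..d, F a s) + ∫ y in a..x, ∫ s in c..d, G y s)
      (∫ s in c..d, G x s) x :=
    (hI.integral_hasStrictDerivAt a x).hasDerivAt.const_add _
  exact h1.hasDerivWithinAt.congr key (key x hx)

/-- `mulVec` as a continuous bilinear map. -/
def mvL : M2 →L[ℝ] (Fin 2 → ℂ) →L[ℝ] (Fin 2 → ℂ) :=
  (LinearMap.mk₂ ℝ (fun (A : M2) (v : Fin 2 → ℂ) => A.mulVec v)
    (fun A B v => Matrix.add_mulVec A B v)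
    (fun c A v => Matrix.smul_mulVec c A v)
    (fun A v w => Matrix.mulVec_add A v w)
    (fun c A v => Matrix.mulVec_smul A c v)).toContinuousBilinearMap

theorem mvL_apply (A : M2) (v : Fin 2 → ℂ) : mvL A v = A.mulVec v := rfl

theorem mvL_smulL (c : ℝ) (A : M2) (v : Fin 2 → ℂ) : mvL (c • A) v = c • mvL A v := by
  simp only [mvL_apply]
  exact Matrix.smul_mulVec c A v

theorem mvL_smulR (c : ℝ) (A : M2) (v : Fin 2 → ℂ) : mvL A (c • v) = c • mvL A v := by
  simp only [mvL_apply]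
  exact Matrix.mulVec_smul A c v

theorem mvL_addL (A A' : M2) (v : Fin 2 → ℂ) : mvL (A + A') v = mvL A v + mvL A' v := by
  simp only [mvL_apply]
  exact Matrix.add_mulVec A A' v

theorem mvL_deriv {A : ℝ → M2} {v : ℝ → Fin 2 → ℂ} {A' : M2} {v' : Fin 2 → ℂ} {S : Set ℝ} {s : ℝ}
    (hA : HasDerivWithinAt A A' S s) (hv : HasDerivWithinAt v v' S s) :
    HasDerivWithinAt (fun s => mvL (A s) (v s)) (mvL (A s) v' + mvL A' (v s)) S s :=
  mvL.hasDerivWithinAt_of_bilinear hA hv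

/-- right multiplication by `Bmat` -/
def rB : M2 →L[ℝ] M2 := (LinearMap.mulRight ℝ (Bmat : M2)).toContinuousLinearMap

theorem rB_apply (A : M2) : rB A = A * Bmat := rfl

/-- left multiplication by `Bmat` -/
def lB : M2 →L[ℝ] M2 := (LinearMap.mulLeft ℝ (Bmat : M2)).toContinuousLinearMap

theorem lB_apply (A : M2) : lB A = Bmat * A := rfl

theorem uniqueDiff_omega (b : ℝ) (hb : 0 < b) :
    UniqueDiffOn ℝ {z : ℝ × ℝ | |z.2| ≤ |z.1| ∧ |z.1| ≤ b} := by
  have conv1 : Convex ℝ {z : ℝ × ℝ | |z.2| ≤ z.1 ∧ z.1 ≤ b} := by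
    rintro ⟨x, t⟩ ⟨h1, h2⟩ ⟨y, s⟩ ⟨h3, h4⟩ u v hu hv huv
    simp only [mem_ofPred_eq, abs_le, Prod.smul_mk, Prod.mk_add_mk, smul_eq_mul] at *
    refine ⟨⟨?_, ?_⟩, ?_⟩ <;> nlinarith
  have conv2 : Convex ℝ {z : ℝ × ℝ | |z.2| ≤ -z.1 ∧ -z.1 ≤ b} := by
    rintro ⟨x, t⟩ ⟨h1, h2⟩ ⟨y, s⟩ ⟨h3, h4⟩ u v hu hv huv
    simp only [mem_ofPred_eq, abs_le, Prod.smul_mk, Prod.mk_add_mk, smul_eq_mul] at *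
    refine ⟨⟨?_, ?_⟩, ?_⟩ <;> nlinarith
  have int1 : (interior {z : ℝ × ℝ | |z.2| ≤ z.1 ∧ z.1 ≤ b}).Nonempty := by
    refine ⟨(b / 2, 0), mem_interior.2 ⟨{z : ℝ × ℝ | |z.2| < z.1 ∧ z.1 < b}, ?_, ?_, ?_⟩⟩
    · exact fun z hz => ⟨hz.1.le, hz.2.le⟩
    · have : IsOpen ({z : ℝ × ℝ | |z.2| < z.1} ∩ {z : ℝ × ℝ | z.1 < b}) := by
        refine IsOpen.inter (isOpen_lt ?_ ?_) (isOpen_lt ?_ ?_) <;> fun_prop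
      exact this
    · constructor <;> simp <;> linarith
  have int2 : (interior {z : ℝ × ℝ | |z.2| ≤ -z.1 ∧ -z.1 ≤ b}).Nonempty := by
    refine ⟨(-(b / 2), 0), mem_interior.2 ⟨{z : ℝ × ℝ | |z.2| < -z.1 ∧ -z.1 < b}, ?_, ?_, ?_⟩⟩
    · exact fun z hz => ⟨hz.1.le, hz.2.le⟩
    · have : IsOpen ({z : ℝ × ℝ | |z.2| < -z.1} ∩ {z : ℝ × ℝ | -z.1 < b}) := by
        refine IsOpen.inter (isOpen_lt ?_ ?_) (isOpen_lt ?_ ?_) <;> fun_prop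
      exact this
    · constructor <;> simp <;> linarith
  rintro ⟨x, t⟩ ⟨h1, h2⟩
  simp only at h1 h2
  rcases le_total 0 x with h | h
  · rw [abs_of_nonneg h] at h1 h2
    refine (uniqueDiffWithinAt_convex conv1 int1 (subset_closure ⟨h1, h2⟩)).mono ?_
    rintro ⟨y, s⟩ ⟨h3, h4⟩
    simp only at h3 h4
    have : 0 ≤ y := (abs_nonneg _).trans h3
    simp only [mem_ofPred_eq, abs_of_nonneg this]
    exact ⟨h3, h4⟩
  · rw [abs_of_nonpos h] at h1 h2
    refine (uniqueDiffWithinAt_convex conv2 int2 (subset_closure ⟨h1, h2⟩)).mono ?_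
    rintro ⟨y, s⟩ ⟨h3, h4⟩
    simp only at h3 h4
    have : y ≤ 0 := by linarith [(abs_nonneg _).trans h3]
    simp only [mem_ofPred_eq, abs_of_nonpos this]
    exact ⟨h3, h4⟩

theorem cont_mul : Continuous (fun z : M2 × M2 => z.1 * z.2) :=
  continuous_fst.matrix_mul continuous_snd

end helpers

set_option maxHeartbeats 4000000 in
/-- the Volterra operator `T` with kernel `K` is a transmutation operator
intertwining `A_Q = B d/dx + Q` and `A₀ = B d/dx` on `C¹` functions. -/
theorem statement0 (b : ℝ) (hb : 0 < b) (p q : ℝ → ℂ)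
    (hQ : ContDiffOn ℝ 1 (diracPot p q) (Set.Icc (-b) b))
    (K : ℝ → ℝ → M2)
    (hK : ContDiffOn ℝ 1 (fun z : ℝ × ℝ => K z.1 z.2)
      {z : ℝ × ℝ | |z.2| ≤ |z.1| ∧ |z.1| ≤ b})
    (hPDE : ∀ x t : ℝ, |t| ≤ |x| → |x| ≤ b →
      Bmat * deriv (fun s => K s t) x + deriv (fun s => K x s) t * Bmat
        = -(diracPot p q x * K x t))
    (hG1 : ∀ x ∈ Set.Icc (-b) b, Bmat * K x x - K x x * Bmat = -(diracPot p q x))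
    (hG2 : ∀ x ∈ Set.Icc (-b) b, Bmat * K x (-x) + K x (-x) * Bmat = 0)
    (T : (ℝ → Fin 2 → ℂ) → ℝ → Fin 2 → ℂ)
    (hT : ∀ (Y : ℝ → Fin 2 → ℂ) (x : ℝ),
      T Y x = Y x + ∫ t in (-x)..x, (K x t).mulVec (Y t))
    (Y : ℝ → Fin 2 → ℂ) (hY : ContDiff ℝ 1 Y) :
    ∀ x ∈ Set.Icc (-b) b,
      Bmat.mulVec (derivWithin (T Y) (Set.Icc (-b) b) x)
          + (diracPot p q x).mulVec (T Y x)
        = Bmat.mulVec (deriv Y x)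
          + ∫ t in (-x)..x, (K x t * Bmat).mulVec (deriv Y t) := by
  intro x hx
  set Om : Set (ℝ × ℝ) := {z : ℝ × ℝ | |z.2| ≤ |z.1| ∧ |z.1| ≤ b} with hOm
  set Kf : ℝ × ℝ → M2 := fun z => K z.1 z.2 with hKf
  set C : ℝ × ℝ → (ℝ × ℝ →L[ℝ] M2) := fun z => fderivWithin ℝ Kf Om z with hC
  have hu := uniqueDiff_omega b hb
  have hCc : ContinuousOn C Om := hK.continuousOn_fderivWithin hu le_rfl
  have hKc : ContinuousOn Kf Om := hK.continuousOn
  have hKd : ∀ z ∈ Om, HasFDerivWithinAt Kf (C z) Om z := fun z hz =>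
    (hK.differentiableOn one_ne_zero z hz).hasFDerivWithinAt
  have hQc := hQ.continuousOn
  have hYc : Continuous Y := hY.continuous
  have hY' : Continuous (deriv Y) := hY.continuous_deriv le_rfl
  have hYd : ∀ y, HasDerivAt Y (deriv Y y) y := fun y =>
    (hY.differentiable one_ne_zero y).hasDerivAt
  have hmem : ∀ y ∈ Icc (-b) b, ∀ s ∈ Icc (-1 : ℝ) 1, (y, y * s) ∈ Om := by
    intro y hy s hs
    refine ⟨?_, abs_le.2 hy⟩
    simp only [abs_mul]
    exact mul_le_of_le_one_right (abs_nonneg _) (abs_le.2 hs)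
  -- continuity helper
  have hmaps : MapsTo (fun z : ℝ × ℝ => (z.1, z.1 * z.2)) (Icc (-b) b ×ˢ Icc (-1 : ℝ) 1) Om :=
    fun z hz => hmem z.1 hz.1 z.2 hz.2
  have hK2 : ContinuousOn (fun z : ℝ × ℝ => K z.1 (z.1 * z.2)) (Icc (-b) b ×ˢ Icc (-1 : ℝ) 1) :=
    hKc.comp (f := fun z : ℝ × ℝ => (z.1, z.1 * z.2)) (by fun_prop) hmaps
  have hC2 : ContinuousOn (fun z : ℝ × ℝ => C (z.1, z.1 * z.2))
      (Icc (-b) b ×ˢ Icc (-1 : ℝ) 1) :=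
    hCc.comp (f := fun z : ℝ × ℝ => (z.1, z.1 * z.2)) (by fun_prop) hmaps
  have hsl : MapsTo (fun s : ℝ => (x, s)) (Icc (-1 : ℝ) 1) (Icc (-b) b ×ˢ Icc (-1 : ℝ) 1) :=
    fun s hs => ⟨hx, hs⟩
  have hK1 : ContinuousOn (fun s : ℝ => K x (x * s)) (Icc (-1 : ℝ) 1) :=
    hK2.comp (f := fun s : ℝ => (x, s)) (by fun_prop) hsl
  have hC1 : ContinuousOn (fun s : ℝ => C (x, x * s)) (Icc (-1 : ℝ) 1) :=
    hC2.comp (f := fun s : ℝ => (x, s)) (by fun_prop) hsl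
  -- the PDE in terms of the derivative within `Om`
  have hpde : ∀ s ∈ Ioo (-1 : ℝ) 1, x ≠ 0 →
      Bmat * C (x, x * s) (1, 0) + C (x, x * s) (0, 1) * Bmat
        + diracPot p q x * K x (x * s) = 0 := by
    intro s hs hx0
    have hr : ∀ r ∈ Icc (0 : ℝ) 1, r * x ∈ Icc (-b) b := by
      intro r hr
      rw [mem_Icc, ← abs_le, abs_mul, abs_of_nonneg hr.1]
      exact (mul_le_of_le_one_left (abs_nonneg _) hr.2).trans (abs_le.2 hx)
    have hm : MapsTo (fun r : ℝ => (r * x, s)) (Icc 0 1) (Icc (-b) b ×ˢ Icc (-1 : ℝ) 1) :=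
      fun r hr' => ⟨hr r hr', Ioo_subset_Icc_self hs⟩
    have hCr : ContinuousOn (fun r : ℝ => C (r * x, r * x * s)) (Icc 0 1) :=
      hC2.comp (f := fun r : ℝ => (r * x, s)) (by fun_prop) hm
    have hKr : ContinuousOn (fun r : ℝ => K (r * x) (r * x * s)) (Icc 0 1) :=
      hK2.comp (f := fun r : ℝ => (r * x, s)) (by fun_prop) hm
    have hQr : ContinuousOn (fun r : ℝ => diracPot p q (r * x)) (Icc 0 1) :=
      hQc.comp (f := fun r : ℝ => r * x) (by fun_prop) hr
    have hE : EqOn (fun r : ℝ => Bmat * C (r * x, r * x * s) (1, 0)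
        + C (r * x, r * x * s) (0, 1) * Bmat
        + diracPot p q (r * x) * K (r * x) (r * x * s)) (fun _ => 0) (Ioo 0 1) := by
      intro r hr'
      have hz : Om ∈ 𝓝 (r * x, r * x * s) := by
        refine mem_of_superset (IsOpen.mem_nhds
          (s := {z : ℝ × ℝ | |z.2| < |z.1| ∧ |z.1| < b}) ?_ ?_) ?_
        · have : IsOpen ({z : ℝ × ℝ | |z.2| < |z.1|} ∩ {z : ℝ × ℝ | |z.1| < b}) := by
            refine IsOpen.inter (isOpen_lt ?_ ?_) (isOpen_lt ?_ ?_) <;> fun_prop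
          exact this
        · have hp : 0 < |r * x| := abs_pos.2 (mul_ne_zero hr'.1.ne' hx0)
          refine ⟨?_, ?_⟩
          · simp only
            rw [abs_mul (r * x) s]
            exact mul_lt_of_lt_one_right hp (abs_lt.2 hs)
          · simp only [abs_mul, abs_of_pos hr'.1]
            exact (mul_lt_of_lt_one_left (abs_pos.2 hx0) hr'.2).trans_le (abs_le.2 hx)
        · exact fun z hz => ⟨hz.1.le, hz.2.le⟩
      have hzm := mem_of_mem_nhds hz
      have hd := (hKd _ hzm).hasFDerivAt hz
      have e1 : deriv (fun y => K y (r * x * s)) (r * x) = C (r * x, r * x * s) (1, 0) :=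
        (hd.comp_hasDerivAt (f := fun y : ℝ => (y, r * x * s)) (r * x)
          ((hasDerivAt_id (r * x)).prodMk (hasDerivAt_const _ _))).deriv
      have e2 : deriv (fun y => K (r * x) y) (r * x * s) = C (r * x, r * x * s) (0, 1) :=
        (hd.comp_hasDerivAt (f := fun y : ℝ => (r * x, y)) (r * x * s)
          ((hasDerivAt_const _ _).prodMk (hasDerivAt_id (r * x * s)))).deriv
      have := hPDE (r * x) (r * x * s) hzm.1 hzm.2
      rw [e1, e2] at this
      simp only [this, neg_add_cancel]
    have hcont : ContinuousOn (fun r : ℝ => Bmat * C (r * x, r * x * s) (1, 0)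
        + C (r * x, r * x * s) (0, 1) * Bmat
        + diracPot p q (r * x) * K (r * x) (r * x * s)) (Icc 0 1) := by
      have c1 : ContinuousOn (fun r : ℝ => C (r * x, r * x * s) (1, 0)) (Icc 0 1) :=
        hCr.clm_apply continuousOn_const
      have c2 : ContinuousOn (fun r : ℝ => C (r * x, r * x * s) (0, 1)) (Icc 0 1) :=
        hCr.clm_apply continuousOn_const
      have c3 : ContinuousOn (fun r : ℝ => diracPot p q (r * x) * K (r * x) (r * x * s))
          (Icc 0 1) := by
        exact cont_mul.comp_continuousOn (hQr.prodMk hKr)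
      exact ((lB.continuous.comp_continuousOn c1).add (rB.continuous.comp_continuousOn c2)).add c3
    have := hE.of_subset_closure hcont continuousOn_const Ioo_subset_Icc_self
      (by rw [closure_Ioo zero_ne_one]) (right_mem_Icc.2 zero_le_one)
    simpa only [one_mul] using this
  -- substitution
  have hsub : ∀ (h : ℝ → Fin 2 → ℂ) (y : ℝ),
      ∫ t in (-y)..y, h t = y • ∫ s in (-1 : ℝ)..1, h (y * s) := by
    intro h y
    rw [intervalIntegral.smul_integral_comp_mul_left]
    simp
  -- the derivative of `T Y`
  set g : ℝ → ℝ → Fin 2 → ℂ := fun y s =>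
    mvL (K y (y * s)) (s • deriv Y (y * s)) + mvL (C (y, y * s) (1, s)) (Y (y * s)) with hg
  have h11 : (-1 : ℝ) ≤ 1 := by norm_num
  have hgc : ContinuousOn (fun z : ℝ × ℝ => g z.1 z.2) (Icc (-b) b ×ˢ Icc (-1 : ℝ) 1) := by
    refine ContinuousOn.add ?_ ?_
    · exact (mvL.continuous.comp_continuousOn hK2).clm_apply (by fun_prop)
    · exact (mvL.continuous.comp_continuousOn (hC2.clm_apply (by fun_prop))).clm_apply
        (by fun_prop)
  have hFd : ∀ s ∈ Icc (-1 : ℝ) 1, ∀ y ∈ Icc (-b) b,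
      HasDerivWithinAt (fun y => mvL (K y (y * s)) (Y (y * s))) (g y s) (Icc (-b) b) y := by
    intro s hs y hy
    have d1 : HasDerivWithinAt (fun y : ℝ => (y, y * s)) (1, s) (Icc (-b) b) y := by
      have := ((hasDerivAt_id y).prodMk ((hasDerivAt_id y).mul_const s)).hasDerivWithinAt
        (s := Icc (-b) b)
      simpa using this
    have d2 : HasDerivWithinAt (fun y => K y (y * s)) (C (y, y * s) (1, s)) (Icc (-b) b) y :=
      (hKd _ (hmem y hy s hs)).comp_hasDerivWithinAt (f := fun y : ℝ => (y, y * s)) y d1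
        (fun w hw => hmem w hw s hs)
    have d3 : HasDerivWithinAt (fun y => Y (y * s)) (s • deriv Y (y * s)) (Icc (-b) b) y := by
      have := (HasDerivAt.scomp y (hYd (y * s)) ((hasDerivAt_id y).mul_const s)).hasDerivWithinAt
        (s := Icc (-b) b)
      exact this.congr_deriv (by simp)
    exact mvL.hasDerivWithinAt_of_bilinear d2 d3
  have hFi : ∀ y ∈ Icc (-b) b,
      IntervalIntegrable (fun s => mvL (K y (y * s)) (Y (y * s))) volume (-1) 1 := by
    intro y hy
    refine ContinuousOn.intervalIntegrable ?_
    rw [uIcc_of_le h11]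
    have : ContinuousOn (fun s : ℝ => K y (y * s)) (Icc (-1 : ℝ) 1) :=
      hK2.comp (f := fun s : ℝ => (y, s)) (by fun_prop) (fun s hs => ⟨hy, hs⟩)
    exact (mvL.continuous.comp_continuousOn this).clm_apply (by fun_prop)
  have hTY : T Y = fun y => Y y + y • ∫ s in (-1 : ℝ)..1, mvL (K y (y * s)) (Y (y * s)) := by
    funext y
    rw [hT, hsub]
    rfl
  have hpar := param_deriv (F := fun y s => mvL (K y (y * s)) (Y (y * s))) (by linarith) h11
    hgc hFd hFi x hx
  have hder : HasDerivWithinAt (T Y) (deriv Y x +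
      (x • (∫ s in (-1 : ℝ)..1, g x s)
        + (1 : ℝ) • ∫ s in (-1 : ℝ)..1, mvL (K x (x * s)) (Y (x * s)))) (Icc (-b) b) x := by
    rw [hTY]
    exact (hYd x).hasDerivWithinAt.add ((hasDerivWithinAt_id x _).smul hpar)
  rw [hder.derivWithin ((uniqueDiffOn_Icc (by linarith)) x hx)]
  -- derivative in `s`
  have dK : ∀ s ∈ Icc (-1 : ℝ) 1, HasDerivWithinAt (fun s => K x (x * s))
      (x • C (x, x * s) (0, 1)) (Icc (-1 : ℝ) 1) s := by
    intro s hs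
    have d1 : HasDerivWithinAt (fun s : ℝ => (x, x * s)) (0, x) (Icc (-1 : ℝ) 1) s := by
      have := ((hasDerivAt_const s x).prodMk ((hasDerivAt_id s).const_mul x)).hasDerivWithinAt
        (s := Icc (-1 : ℝ) 1)
      simpa using this
    have := (hKd _ (hmem x hx s hs)).comp_hasDerivWithinAt (f := fun s : ℝ => (x, x * s)) s d1
        (fun w hw => hmem x hx w hw)
    rw [← map_smul]
    exact this.congr_deriv (congrArg (C (x, x * s)) (by simp))
  have dY : ∀ s, HasDerivWithinAt (fun s => Y (x * s)) (x • deriv Y (x * s))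
      (Icc (-1 : ℝ) 1) s := by
    intro s
    have := (HasDerivAt.scomp s (hYd (x * s)) ((hasDerivAt_id s).const_mul x)).hasDerivWithinAt
        (s := Icc (-1 : ℝ) 1)
    exact this.congr_deriv (by simp)
  -- continuity on `[-1, 1]`
  have cY : ContinuousOn (fun s => Y (x * s)) (Icc (-1 : ℝ) 1) := by fun_prop
  have cY' : ContinuousOn (fun s => deriv Y (x * s)) (Icc (-1 : ℝ) 1) := by fun_prop
  have cKx : ContinuousOn (fun s => C (x, x * s) (1, 0)) (Icc (-1 : ℝ) 1) :=
    hC1.clm_apply continuousOn_const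
  have cKt : ContinuousOn (fun s => C (x, x * s) (0, 1)) (Icc (-1 : ℝ) 1) :=
    hC1.clm_apply continuousOn_const
  have cmv : ∀ {A : ℝ → M2} {v : ℝ → Fin 2 → ℂ}, ContinuousOn A (Icc (-1 : ℝ) 1) →
      ContinuousOn v (Icc (-1 : ℝ) 1) → ContinuousOn (fun s => mvL (A s) (v s))
        (Icc (-1 : ℝ) 1) := fun hA hv => (mvL.continuous.comp_continuousOn hA).clm_apply hv
  have ii : ∀ {v : ℝ → Fin 2 → ℂ}, ContinuousOn v (Icc (-1 : ℝ) 1) →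
      IntervalIntegrable v volume (-1) 1 := fun hv =>
    ContinuousOn.intervalIntegrable (by rwa [uIcc_of_le h11])
  have cB : ContinuousOn (fun s => K x (x * s) * Bmat) (Icc (-1 : ℝ) 1) :=
    rB.continuous.comp_continuousOn hK1
  have cg : ContinuousOn (fun s => g x s) (Icc (-1 : ℝ) 1) :=
    hgc.comp (f := fun s : ℝ => (x, s)) (by fun_prop) hsl
  -- first integration by parts
  have ibp1 : ∫ s in (-1 : ℝ)..1, (x • g x s + mvL (K x (x * s)) (Y (x * s))
        - x • mvL (C (x, x * s) (1, 0)) (Y (x * s)))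
      = mvL (K x x) (Y x) + mvL (K x (-x)) (Y (-x)) := by
    rw [ftc_within (f := fun s => s • mvL (K x (x * s)) (Y (x * s))) h11]
    · simp
    · intro s hs
      have d := (hasDerivWithinAt_id s (Icc (-1 : ℝ) 1)).smul
        (mvL_deriv (dK s hs) (dY s))
      refine d.congr_deriv ?_
      have : ((1 : ℝ), s) = (1, 0) + s • ((0 : ℝ), (1 : ℝ)) := by simp
      have e1 : mvL (C (x, x * s) (1, s)) (Y (x * s)) = mvL (C (x, x * s) (1, 0)) (Y (x * s))
          + s • mvL (C (x, x * s) (0, 1)) (Y (x * s)) := by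
        rw [this, map_add, map_smul]
        exact (mvL_addL _ _ _).trans (congrArg _ (mvL_smulL _ _ _))
      have e2 : mvL (x • C (x, x * s) (0, 1)) (Y (x * s))
          = x • mvL (C (x, x * s) (0, 1)) (Y (x * s)) := mvL_smulL _ _ _
      have e3 : ∀ c : ℝ, mvL (K x (x * s)) (c • deriv Y (x * s))
          = c • mvL (K x (x * s)) (deriv Y (x * s)) := fun c => mvL_smulR _ _ _
      simp only [hg]
      rw [e1, e2, e3, e3, id]
      module
    · exact ((cg.const_smul x).add (cmv hK1 cY)).sub ((cmv cKx cY).const_smul x)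
  -- second integration by parts
  have ibp2 : ∫ s in (-1 : ℝ)..1, (x • mvL (K x (x * s) * Bmat) (deriv Y (x * s))
        + x • mvL (C (x, x * s) (0, 1) * Bmat) (Y (x * s)))
      = mvL (K x x * Bmat) (Y x) - mvL (K x (-x) * Bmat) (Y (-x)) := by
    rw [ftc_within (f := fun s => mvL (K x (x * s) * Bmat) (Y (x * s))) h11]
    · simp
    · intro s hs
      have d0 : HasDerivWithinAt (fun s => K x (x * s) * Bmat)
          (rB (x • C (x, x * s) (0, 1))) (Icc (-1 : ℝ) 1) s :=
        rB.hasFDerivAt.comp_hasDerivWithinAt s (dK s hs)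
      have d := mvL_deriv d0 (dY s)
      refine d.congr_deriv ?_
      have e2 : mvL (rB (x • C (x, x * s) (0, 1))) (Y (x * s))
          = x • mvL (C (x, x * s) (0, 1) * Bmat) (Y (x * s)) := by
        rw [map_smul]
        exact mvL_smulL _ _ _
      have e3 : mvL (K x (x * s) * Bmat) (x • deriv Y (x * s))
          = x • mvL (K x (x * s) * Bmat) (deriv Y (x * s)) := mvL_smulR _ _ _
      rw [e2, e3]
    · exact ((cmv cB cY').const_smul x).add
        ((cmv (rB.continuous.comp_continuousOn cKt) cY).const_smul x)
  have i1 : IntervalIntegrable (fun s => mvL (C (x, x * s) (1, 0)) (Y (x * s))) volume (-1) 1 :=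
    ii (cmv cKx cY)
  have i2 : IntervalIntegrable (fun s => mvL (C (x, x * s) (0, 1) * Bmat) (Y (x * s)))
      volume (-1) 1 := ii (cmv (rB.continuous.comp_continuousOn cKt) cY)
  have i3 : IntervalIntegrable (fun s => mvL (K x (x * s)) (Y (x * s))) volume (-1) 1 :=
    ii (cmv hK1 cY)
  have i4 : IntervalIntegrable (fun s => mvL Bmat (mvL (C (x, x * s) (1, 0)) (Y (x * s))))
      volume (-1) 1 := ii ((mvL Bmat).continuous.comp_continuousOn (cmv cKx cY))
  have i5 : IntervalIntegrable (fun s => mvL (diracPot p q x) (mvL (K x (x * s)) (Y (x * s))))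
      volume (-1) 1 := ii ((mvL (diracPot p q x)).continuous.comp_continuousOn (cmv hK1 cY))
  have i6 : IntervalIntegrable (fun s => x • g x s) volume (-1) 1 := ii (cg.const_smul x)
  have i7 : IntervalIntegrable (fun s => x • mvL (C (x, x * s) (1, 0)) (Y (x * s)))
      volume (-1) 1 := ii ((cmv cKx cY).const_smul x)
  have i8 : IntervalIntegrable (fun s => x • mvL (K x (x * s) * Bmat) (deriv Y (x * s)))
      volume (-1) 1 := ii ((cmv cB cY').const_smul x)
  have i9 : IntervalIntegrable (fun s => x • mvL (C (x, x * s) (0, 1) * Bmat) (Y (x * s)))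
      volume (-1) 1 := ii ((cmv (rB.continuous.comp_continuousOn cKt) cY).const_smul x)
  -- the integrated PDE
  have hPint : x • ((mvL Bmat (∫ s in (-1 : ℝ)..1, mvL (C (x, x * s) (1, 0)) (Y (x * s))))
      + (∫ s in (-1 : ℝ)..1, mvL (C (x, x * s) (0, 1) * Bmat) (Y (x * s)))
      + mvL (diracPot p q x) (∫ s in (-1 : ℝ)..1, mvL (K x (x * s)) (Y (x * s)))) = 0 := by
    rcases eq_or_ne x 0 with h0 | h0
    · rw [h0, zero_smul]
    rw [← ContinuousLinearMap.intervalIntegral_comp_comm _ i1,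
      ← ContinuousLinearMap.intervalIntegral_comp_comm _ i3,
      ← intervalIntegral.integral_add i4 i2, ← intervalIntegral.integral_add (i4.add i2) i5]
    rw [intervalIntegral.integral_congr_Ioo_of_le h11 (g := fun _ => 0)]
    · simp
    · intro s hs
      have := hpde s hs h0
      simp only [mvL_apply, Matrix.mulVec_mulVec, ← Matrix.add_mulVec, this, Matrix.zero_mulVec]
  rw [intervalIntegral.integral_sub (i6.add i3) i7, intervalIntegral.integral_add i6 i3,
    intervalIntegral.integral_smul, intervalIntegral.integral_smul, sub_eq_iff_eq_add] at ibp1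
  rw [intervalIntegral.integral_add i8 i9,
    intervalIntegral.integral_smul, intervalIntegral.integral_smul, ← eq_sub_iff_add_eq] at ibp2
  have g1 : mvL Bmat (mvL (K x x) (Y x)) - mvL (K x x * Bmat) (Y x)
      + mvL (diracPot p q x) (Y x) = 0 := by
    have := hG1 x hx
    simp only [mvL_apply, Matrix.mulVec_mulVec, ← Matrix.sub_mulVec, ← Matrix.add_mulVec, this,
      neg_add_cancel, Matrix.zero_mulVec]
  have g2 : mvL Bmat (mvL (K x (-x)) (Y (-x))) + mvL (K x (-x) * Bmat) (Y (-x)) = 0 := by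
    have := hG2 x hx
    simp only [mvL_apply, Matrix.mulVec_mulVec, ← Matrix.add_mulVec, this, Matrix.zero_mulVec]
  rw [one_smul, ibp1, hTY, hsub (fun t => (K x t * Bmat).mulVec (deriv Y t)) x]
  simp only [← mvL_apply]
  rw [ibp2]
  simp only [map_add, map_smul]
  simp only [smul_add] at hPint
  linear_combination g1 + g2 + hPint

end
end

section
/- Let r ≥ 1 be an integer and let Q be a Dirac potential on [0,b] whose entries are r-times continuously differentiable. Then there exists a transmutation kernel K for Q which is r-times continuously differentiable on Ω⁺, i.e. K ∈ C^r(Ω⁺, M₂). -/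
noncomputable section

open MeasureTheory Set Filter Topology Polynomial intervalIntegral

attribute [local instance] Matrix.normedAddCommGroup Matrix.normedSpace

/-- A function of two real variables with `C^k` partial derivatives is `C^(k+1)`. -/
lemma contDiff_of_partials (k : ℕ) (F Fu Fv : ℝ → ℝ → ℂ)
    (hu : ∀ u v, HasDerivAt (fun s => F s v) (Fu u v) u)
    (hv : ∀ u v, HasDerivAt (fun s => F u s) (Fv u v) v)
    (cu : ContDiff ℝ k (fun z : ℝ × ℝ => Fu z.1 z.2))
    (cv : ContDiff ℝ k (fun z : ℝ × ℝ => Fv z.1 z.2)) :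
    ContDiff ℝ (k + 1) (fun z : ℝ × ℝ => F z.1 z.2) := by
  rw [contDiff_succ_iff_hasFDerivAt]
  refine ⟨fun z => (ContinuousLinearMap.toSpanSingleton ℝ (Fu z.1 z.2)).coprod
    (ContinuousLinearMap.toSpanSingleton ℝ (Fv z.1 z.2)), ?_, ?_⟩
  · rw [contDiff_clm_apply_iff]
    intro y
    simp only [ContinuousLinearMap.coprod_apply, ContinuousLinearMap.toSpanSingleton_apply]
    exact (cu.const_smul y.1).add (cv.const_smul y.2)
  · intro z
    refine (hasStrictFDerivAt_uncurry_coprod (𝕜 := ℝ) (u := z) (f := F)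
      (f₁ := fun u v => ContinuousLinearMap.toSpanSingleton ℝ (Fu u v))
      (f₂ := fun u v => ContinuousLinearMap.toSpanSingleton ℝ (Fv u v)) ?_ ?_ ?_ ?_).hasFDerivAt
    · exact Eventually.of_forall fun w => (hu w.1 w.2).hasFDerivAt
    · exact Eventually.of_forall fun w => (hv w.1 w.2).hasFDerivAt
    · apply Continuous.continuousAt
      rw [continuous_clm_apply]
      intro y
      exact (cu.continuous.const_smul y)
    · apply Continuous.continuousAt
      rw [continuous_clm_apply]
      intro y
      exact (cv.continuous.const_smul y)

lemma hasDerivAt_param (f f' : ℝ → ℝ → ℂ) (u v : ℝ)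
    (hf : ∀ s v, HasDerivAt (fun y => f s y) (f' s v) v)
    (cf : Continuous (fun z : ℝ × ℝ => f z.1 z.2))
    (cf' : Continuous (fun z : ℝ × ℝ => f' z.1 z.2)) :
    HasDerivAt (fun y => ∫ s in (0:ℝ)..u, f s y) (∫ s in (0:ℝ)..u, f' s v) v := by
  obtain ⟨C, hC⟩ := ((isCompact_uIcc (a := (0:ℝ)) (b := u)).prod
    (isCompact_closedBall v 1)).exists_bound_of_continuousOn cf'.continuousOn
  have c1 : ∀ y, Continuous (fun s => f s y) := fun y =>
    cf.comp (continuous_id.prodMk continuous_const)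
  have c2 : ∀ y, Continuous (fun s => f' s y) := fun y =>
    cf'.comp (continuous_id.prodMk continuous_const)
  refine (intervalIntegral.hasDerivAt_integral_of_dominated_loc_of_deriv_le
    (F := fun y s => f s y) (F' := fun y s => f' s y) (bound := fun _ => C)
    (Metric.closedBall_mem_nhds v one_pos) ?_ ((c1 v).intervalIntegrable _ _) ?_ ?_ ?_ ?_).2
  · exact Eventually.of_forall fun y => (c1 y).aestronglyMeasurable
  · exact (c2 v).aestronglyMeasurable
  · exact Eventually.of_forall fun s hs y hy => hC (s, y) ⟨uIoc_subset_uIcc hs, hy⟩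
  · exact intervalIntegrable_const
  · exact Eventually.of_forall fun s hs y hy => hf s y

lemma continuous_prim (f : ℝ → ℝ → ℂ) (cf : Continuous (fun z : ℝ × ℝ => f z.1 z.2)) :
    Continuous (fun z : ℝ × ℝ => ∫ s in (0:ℝ)..z.1, f s z.2) := by
  refine intervalIntegral.continuous_parametric_intervalIntegral_of_continuous
    (f := fun (z : ℝ × ℝ) s => f s z.2) ?_ continuous_fst
  exact cf.comp (continuous_snd.prodMk (continuous_snd.comp continuous_fst))

lemma hasDerivAt_prim (f : ℝ → ℝ → ℂ) (cf : Continuous (fun z : ℝ × ℝ => f z.1 z.2)) (u v : ℝ) :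
    HasDerivAt (fun x => ∫ s in (0:ℝ)..x, f s v) (f u v) u := by
  have c1 : Continuous (fun s => f s v) := cf.comp (continuous_id.prodMk continuous_const)
  exact (c1.integral_hasStrictDerivAt 0 u).hasDerivAt

lemma contDiff_prim (k : ℕ) : ∀ (f : ℝ → ℝ → ℂ), ContDiff ℝ k (fun z : ℝ × ℝ => f z.1 z.2) →
    ContDiff ℝ k (fun z : ℝ × ℝ => ∫ s in (0:ℝ)..z.1, f s z.2) := by
  induction k with
  | zero =>
    intro f hf
    simp only [Nat.cast_zero, contDiff_zero] at hf ⊢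
    exact continuous_prim f hf
  | succ k ih =>
    intro f hf
    have hd : ∀ s v, HasDerivAt (fun y => f s y)
        (fderiv ℝ (fun z : ℝ × ℝ => f z.1 z.2) (s, v) (0, 1)) v := by
      intro s v
      have h1 : HasFDerivAt (fun z : ℝ × ℝ => f z.1 z.2) _ (s, v) :=
        (hf.differentiable (by simp)).differentiableAt.hasFDerivAt
      have h2 : HasDerivAt (fun y : ℝ => (s, y)) ((0 : ℝ), (1 : ℝ)) v :=
        (hasDerivAt_const v s).prodMk (hasDerivAt_id v)
      exact h1.comp_hasDerivAt v h2
    have hc : ContDiff ℝ k (fun z : ℝ × ℝ =>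
        fderiv ℝ (fun z : ℝ × ℝ => f z.1 z.2) z (0, 1)) :=
      (hf.fderiv_right (m := k) (by simp)).clm_apply contDiff_const
    push_cast
    refine contDiff_of_partials k (fun u v => ∫ s in (0:ℝ)..u, f s v) f
      (fun u v => ∫ s in (0:ℝ)..u, fderiv ℝ (fun z : ℝ × ℝ => f z.1 z.2) (s, v) (0, 1))
      (fun u v => hasDerivAt_prim f hf.continuous u v) (fun u v => ?_) ?_ ?_
    · exact hasDerivAt_param f _ u v hd hf.continuous hc.continuous
    · exact hf.of_le (by simp)
    · exact ih (fun s v => fderiv ℝ (fun z : ℝ × ℝ => f z.1 z.2) (s, v) (0, 1)) hc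

/-- Half of the bootstrap. -/
lemma boot (k : ℕ) (a c : ℝ → ℝ → ℂ) (w₁ w₂ g : ℝ → ℂ)
    (hw₁ : ContDiff ℝ (k + 1) w₁) (hw₂ : ContDiff ℝ (k + 1) w₂) (hg : ContDiff ℝ (k + 1) g)
    (ha : ContDiff ℝ k (fun z : ℝ × ℝ => a z.1 z.2))
    (hc : ContDiff ℝ k (fun z : ℝ × ℝ => c z.1 z.2))
    (ea : ∀ x y, a x y = g y + ∫ s in (0:ℝ)..x, w₁ (s + y) * c y s)
    (hcx : ∀ x y, HasDerivAt (fun s => c s y) (w₂ (x + y) * a y x) x) :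
    ContDiff ℝ (k + 1) (fun z : ℝ × ℝ => a z.1 z.2) := by
  have hdw : ContDiff ℝ k (deriv w₁) := (contDiff_succ_iff_deriv.1 hw₁).2.2
  have hdg : ContDiff ℝ k (deriv g) := (contDiff_succ_iff_deriv.1 hg).2.2
  have hle : (k : WithTop ℕ∞) ≤ k + 1 := by exact_mod_cast Nat.le_succ k
  have hw₁k := hw₁.of_le hle
  have hw₂k := hw₂.of_le hle
  have hsum : ContDiff ℝ k (fun z : ℝ × ℝ => z.1 + z.2) := contDiff_fst.add contDiff_snd
  have hsw : ContDiff ℝ k (fun z : ℝ × ℝ => (z.2, z.1)) := contDiff_snd.prodMk contDiff_fst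
  have hcs : ContDiff ℝ k (fun z : ℝ × ℝ => c z.2 z.1) := hc.comp hsw
  have hf : ContDiff ℝ k (fun z : ℝ × ℝ => w₁ (z.1 + z.2) * c z.2 z.1) :=
    (hw₁k.comp hsum).mul hcs
  have hf' : ContDiff ℝ k (fun z : ℝ × ℝ => deriv w₁ (z.1 + z.2) * c z.2 z.1 +
      w₁ (z.1 + z.2) * (w₂ (z.2 + z.1) * a z.1 z.2)) := by
    refine ((hdw.comp hsum).mul hcs).add ((hw₁k.comp hsum).mul
      ((hw₂k.comp (contDiff_snd.add contDiff_fst)).mul ha))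
  have hdiff : ∀ s y, HasDerivAt (fun y => w₁ (s + y) * c y s)
      (deriv w₁ (s + y) * c y s + w₁ (s + y) * (w₂ (y + s) * a s y)) y := by
    intro s y
    have h1 : HasDerivAt w₁ (deriv w₁ (s + y)) (s + y) :=
      ((contDiff_succ_iff_deriv.1 hw₁).1 _).hasDerivAt
    exact (HasDerivAt.comp_const_add s y h1).mul (hcx y s)
  have e : a = fun x y => g y + ∫ s in (0:ℝ)..x, w₁ (s + y) * c y s := by
    funext x y; exact ea x y
  refine contDiff_of_partials k a (fun x y => w₁ (x + y) * c y x)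
    (fun x y => deriv g y + ∫ s in (0:ℝ)..x, (deriv w₁ (s + y) * c y s +
      w₁ (s + y) * (w₂ (y + s) * a s y))) ?_ ?_ hf ?_
  · intro u v
    have := (hasDerivAt_prim (fun s y => w₁ (s + y) * c y s) hf.continuous u v).const_add (g v)
    simp only [ea]
    exact this
  · intro u v
    have h2 := hasDerivAt_param (fun s y => w₁ (s + y) * c y s) _ u v hdiff
      hf.continuous hf'.continuous
    have h3 : HasDerivAt g (deriv g v) v := ((contDiff_succ_iff_deriv.1 hg).1 _).hasDerivAt
    have e2 : (fun s => a u s) = fun y => g y + ∫ s in (0:ℝ)..u, w₁ (s + y) * c y s := by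
      funext y; exact ea u y
    rw [e2]
    exact h3.add h2
  · exact (hdg.comp contDiff_snd).add (contDiff_prim k (fun s y =>
      deriv w₁ (s + y) * c y s + w₁ (s + y) * (w₂ (y + s) * a s y)) hf')

lemma regularity (r : ℕ) (a c : ℝ → ℝ → ℂ) (w₁ w₂ g₁ g₂ : ℝ → ℂ)
    (hw₁ : ContDiff ℝ r w₁) (hw₂ : ContDiff ℝ r w₂) (hg₁ : ContDiff ℝ r g₁)
    (hg₂ : ContDiff ℝ r g₂)
    (ha : Continuous (fun z : ℝ × ℝ => a z.1 z.2))
    (hc : Continuous (fun z : ℝ × ℝ => c z.1 z.2))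
    (ea : ∀ x y, a x y = g₁ y + ∫ s in (0:ℝ)..x, w₁ (s + y) * c y s)
    (ec : ∀ x y, c x y = g₂ y + ∫ s in (0:ℝ)..x, w₂ (s + y) * a y s) :
    (ContDiff ℝ r (fun z : ℝ × ℝ => a z.1 z.2) ∧ ContDiff ℝ r (fun z : ℝ × ℝ => c z.1 z.2)) ∧
    (∀ x y, HasDerivAt (fun s => a s y) (w₁ (x + y) * c y x) x) ∧
    (∀ x y, HasDerivAt (fun s => c s y) (w₂ (x + y) * a y x) x) := by
  have key : ∀ (a c : ℝ → ℝ → ℂ) (w g : ℝ → ℂ), ContDiff ℝ r w →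
      Continuous (fun z : ℝ × ℝ => c z.1 z.2) →
      (∀ x y, a x y = g y + ∫ s in (0:ℝ)..x, w (s + y) * c y s) →
      ∀ x y, HasDerivAt (fun s => a s y) (w (x + y) * c y x) x := by
    intro a c w g hw hc ea x y
    have hf : Continuous (fun z : ℝ × ℝ => w (z.1 + z.2) * c z.2 z.1) :=
      (hw.continuous.comp (continuous_fst.add continuous_snd)).mul
        (hc.comp (continuous_snd.prodMk continuous_fst))
    simp only [ea]
    exact (hasDerivAt_prim (fun s y => w (s + y) * c y s) hf x y).const_add (g y)
  have hax := key a c w₁ g₁ hw₁ hc ea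
  have hcx := key c a w₂ g₂ hw₂ ha ec
  refine ⟨?_, hax, hcx⟩
  have main : ∀ k : ℕ, k ≤ r → ContDiff ℝ k (fun z : ℝ × ℝ => a z.1 z.2) ∧
      ContDiff ℝ k (fun z : ℝ × ℝ => c z.1 z.2) := by
    intro k
    induction k with
    | zero =>
      intro _
      simp only [Nat.cast_zero, contDiff_zero]
      exact ⟨ha, hc⟩
    | succ k ih =>
      intro hk
      obtain ⟨h1, h2⟩ := ih (by omega)
      have hle : ((k : WithTop ℕ∞) + 1) ≤ r := by exact_mod_cast hk
      push_cast
      exact ⟨boot k a c w₁ w₂ g₁ (hw₁.of_le hle) (hw₂.of_le hle) (hg₁.of_le hle) h1 h2 ea hcx,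
        boot k c a w₂ w₁ g₂ (hw₂.of_le hle) (hw₁.of_le hle) (hg₂.of_le hle) h2 h1 ec hax⟩
  exact main r le_rfl

lemma norm_integral_exp_le (f : ℝ → ℂ) (C l : ℝ) (hl : 0 < l) (hC : 0 ≤ C)
    (h : ∀ s, ‖f s‖ ≤ C * Real.exp (l * |s|)) (x : ℝ) :
    ‖∫ s in (0:ℝ)..x, f s‖ ≤ C * Real.exp (l * |x|) / l := by
  have pos : ∀ (f : ℝ → ℂ), (∀ s, ‖f s‖ ≤ C * Real.exp (l * |s|)) → ∀ x, 0 ≤ x →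
      ‖∫ s in (0:ℝ)..x, f s‖ ≤ C * Real.exp (l * |x|) / l := by
    intro f h x hx
    have h1 : ‖∫ s in (0:ℝ)..x, f s‖ ≤ ∫ s in (0:ℝ)..x, C * Real.exp (l * s) := by
      refine intervalIntegral.norm_integral_le_of_norm_le hx ?_ ?_
      · refine Eventually.of_forall fun s hs => ?_
        have := h s
        rwa [abs_of_pos hs.1] at this
      · exact (by fun_prop : Continuous fun s => C * Real.exp (l * s)).intervalIntegrable _ _
    have h2 : ∫ s in (0:ℝ)..x, C * Real.exp (l * s)
        = C * Real.exp (l * x) / l - C * Real.exp (l * 0) / l := by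
      refine intervalIntegral.integral_eq_sub_of_hasDerivAt
        (f := fun s => C * Real.exp (l * s) / l) (fun s _ => ?_) ?_
      · have := (((hasDerivAt_id s).const_mul l).exp.const_mul C).div_const l
        refine this.congr_deriv ?_
        simp only [id]
        field_simp
      · exact (by fun_prop : Continuous fun s => C * Real.exp (l * s)).intervalIntegrable _ _
    rw [h2] at h1
    rw [abs_of_nonneg hx]
    have : 0 ≤ C * Real.exp (l * 0) / l := by positivity
    linarith
  rcases le_total 0 x with hx | hx
  · exact pos f h x hx
  · have h3 := pos (fun s => f (-s)) (fun s => by simpa using h (-s)) (-x) (by linarith)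
    rw [intervalIntegral.integral_comp_neg, intervalIntegral.integral_symm] at h3
    simpa using h3

open BoundedContinuousFunction in
lemma exists_step (w g : ℝ → ℂ) (M D : ℝ) (hM : 0 < M) (hw : Continuous w) (hg : Continuous g)
    (bw : ∀ x, ‖w x‖ ≤ M) (bg : ∀ x, ‖g x‖ ≤ D) :
    ∃ S : (ℝ × ℝ →ᵇ ℂ) → (ℝ × ℝ →ᵇ ℂ), LipschitzWith (1/2) S ∧
      ∀ G x y, (Real.exp (2 * M * (|x| + |y|)) : ℂ) * S G (x, y) = g y + ∫ s in (0:ℝ)..x,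
        w (s + y) * ((Real.exp (2 * M * (|y| + |s|)) : ℂ) * G (y, s)) := by
  have hD : 0 ≤ D := (norm_nonneg _).trans (bg 0)
  have cint : ∀ G : ℝ × ℝ →ᵇ ℂ, Continuous (fun z : ℝ × ℝ => ∫ s in (0:ℝ)..z.1,
      w (s + z.2) * ((Real.exp (2 * M * (|z.2| + |s|)) : ℂ) * G (z.2, s))) := by
    intro G
    exact continuous_prim (fun s y => w (s + y) *
      ((Real.exp (2 * M * (|y| + |s|)) : ℂ) * G (y, s))) (by fun_prop)
  have bint : ∀ (H : ℝ → ℂ) (N : ℝ) (x y : ℝ), 0 ≤ N → (∀ s, ‖H s‖ ≤ N) →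
      ‖∫ s in (0:ℝ)..x, w (s + y) * ((Real.exp (2 * M * (|y| + |s|)) : ℂ) * H s)‖ ≤
        Real.exp (2 * M * (|x| + |y|)) * (N / 2) := by
    intro H N x y hN hH
    have := norm_integral_exp_le (fun s => w (s + y) *
      ((Real.exp (2 * M * (|y| + |s|)) : ℂ) * H s)) (M * N * Real.exp (2 * M * |y|)) (2 * M)
      (by positivity) (by positivity) (fun s => ?_) x
    · refine this.trans (le_of_eq ?_)
      rw [mul_add, Real.exp_add]
      field_simp
    · rw [norm_mul, norm_mul, Complex.norm_real, Real.norm_of_nonneg (Real.exp_pos _).le,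
        mul_add, Real.exp_add]
      calc _ ≤ M * (Real.exp (2 * M * |y|) * Real.exp (2 * M * |s|) * N) := by
            gcongr
            · exact bw _
            · exact hH s
        _ = _ := by ring
  have e1 : ∀ x y : ℝ, ‖((Real.exp (2 * M * (|x| + |y|)) : ℂ))⁻¹‖
      = (Real.exp (2 * M * (|x| + |y|)))⁻¹ := fun x y => by
    rw [norm_inv, Complex.norm_real, Real.norm_of_nonneg (Real.exp_pos _).le]
  have e2 : ∀ x y : ℝ, (Real.exp (2 * M * (|x| + |y|)))⁻¹ ≤ 1 := fun x y =>
    inv_le_one_of_one_le₀ (Real.one_le_exp (by positivity))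
  have ne : ∀ x y : ℝ, (Real.exp (2 * M * (|x| + |y|)) : ℂ) ≠ 0 := fun x y => by
    exact_mod_cast (Real.exp_pos _).ne'
  let S : (ℝ × ℝ →ᵇ ℂ) → (ℝ × ℝ →ᵇ ℂ) := fun G =>
    BoundedContinuousFunction.ofNormedAddCommGroup
      (fun z : ℝ × ℝ => (Real.exp (2 * M * (|z.1| + |z.2|)) : ℂ)⁻¹ * (g z.2 +
        ∫ s in (0:ℝ)..z.1, w (s + z.2) * ((Real.exp (2 * M * (|z.2| + |s|)) : ℂ) * G (z.2, s))))
      (((by fun_prop : Continuous fun z : ℝ × ℝ =>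
          (Real.exp (2 * M * (|z.1| + |z.2|)) : ℂ)).inv₀ (fun z => ne _ _)).mul
          ((hg.comp continuous_snd).add (cint G)))
      (D + ‖G‖ / 2) (by
        rintro ⟨x, y⟩
        dsimp only
        rw [mul_add]
        refine (norm_add_le _ _).trans (add_le_add ?_ ?_)
        · rw [norm_mul, e1]
          calc _ ≤ 1 * D := by gcongr; exacts [e2 _ _, bg _]
            _ = D := one_mul _
        · rw [norm_mul, e1, inv_mul_le_iff₀ (Real.exp_pos _)]
          exact bint _ _ x y (norm_nonneg _) (fun s => G.norm_coe_le_norm _))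
  have hS : ∀ G x y, S G (x, y) = (Real.exp (2 * M * (|x| + |y|)) : ℂ)⁻¹ * (g y +
        ∫ s in (0:ℝ)..x, w (s + y) * ((Real.exp (2 * M * (|y| + |s|)) : ℂ) * G (y, s))) :=
    fun G x y => rfl
  refine ⟨S, ?_, ?_⟩
  · refine LipschitzWith.of_dist_le_mul fun G H => ?_
    rw [BoundedContinuousFunction.dist_le (by positivity)]
    rintro ⟨x, y⟩
    have ci : ∀ G : ℝ × ℝ →ᵇ ℂ, IntervalIntegrable (fun s => w (s + y) *
        ((Real.exp (2 * M * (|y| + |s|)) : ℂ) * G (y, s))) volume 0 x := fun G =>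
      (by fun_prop : Continuous fun s => w (s + y) *
        ((Real.exp (2 * M * (|y| + |s|)) : ℂ) * G (y, s))).intervalIntegrable _ _
    rw [dist_eq_norm, hS, hS, ← mul_sub, add_sub_add_left_eq_sub,
      ← intervalIntegral.integral_sub (ci G) (ci H), norm_mul, e1,
      inv_mul_le_iff₀ (Real.exp_pos _)]
    have := bint (fun s => G (y, s) - H (y, s)) (dist G H) x y dist_nonneg (fun s => by
      rw [← dist_eq_norm]; exact BoundedContinuousFunction.dist_coe_le_dist _)
    simp only [mul_sub] at this
    refine this.trans (le_of_eq ?_)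
    simp; ring
  · intro G x y
    rw [hS, mul_inv_cancel_left₀ (ne x y)]

lemma exists_sol (w₁ w₂ g₁ g₂ : ℝ → ℂ) (M : ℝ) (hM : 0 < M)
    (c₁ : Continuous w₁) (c₂ : Continuous w₂) (d₁ : Continuous g₁) (d₂ : Continuous g₂)
    (b₁ : ∀ x, ‖w₁ x‖ ≤ M) (b₂ : ∀ x, ‖w₂ x‖ ≤ M) (e₁ : ∀ x, ‖g₁ x‖ ≤ M) (e₂ : ∀ x, ‖g₂ x‖ ≤ M) :
    ∃ a c : ℝ → ℝ → ℂ, Continuous (fun z : ℝ × ℝ => a z.1 z.2) ∧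
      Continuous (fun z : ℝ × ℝ => c z.1 z.2) ∧
      (∀ x y, a x y = g₁ y + ∫ s in (0:ℝ)..x, w₁ (s + y) * c y s) ∧
      (∀ x y, c x y = g₂ y + ∫ s in (0:ℝ)..x, w₂ (s + y) * a y s) := by
  obtain ⟨S₁, l₁, h₁⟩ := exists_step w₁ g₁ M M hM c₁ d₁ b₁ e₁
  obtain ⟨S₂, l₂, h₂⟩ := exists_step w₂ g₂ M M hM c₂ d₂ b₂ e₂
  have hcon : ContractingWith (1/2 * (1/2)) (S₁ ∘ S₂) := by
    refine ⟨?_, l₁.comp l₂⟩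
    rw [← NNReal.coe_lt_coe]
    push_cast
    norm_num
  set A := ContractingWith.fixedPoint (S₁ ∘ S₂) hcon with hA
  have hfix : S₁ (S₂ A) = A := hcon.fixedPoint_isFixedPt
  refine ⟨fun x y => (Real.exp (2 * M * (|x| + |y|)) : ℂ) * A (x, y),
    fun x y => (Real.exp (2 * M * (|x| + |y|)) : ℂ) * S₂ A (x, y), by fun_prop, by fun_prop, ?_, ?_⟩
  · intro x y
    have := h₁ (S₂ A) x y
    rw [hfix] at this
    exact this
  · intro x y
    exact h₂ A x y

/-- Extension of a `C^r` function on `[0,b]` to a `C^r` function on the line. -/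
lemma exists_ext (b : ℝ) (hb : 0 < b) (r : ℕ) : ∀ f : ℝ → ℂ, ContDiffOn ℝ r f (Icc 0 b) →
    ∃ F : ℝ → ℂ, ContDiff ℝ r F ∧ ∀ x ∈ Icc 0 b, F x = f x := by
  induction r with
  | zero =>
    intro f hf
    simp only [Nat.cast_zero, contDiffOn_zero, contDiff_zero] at hf ⊢
    exact ⟨IccExtend hb.le ((Icc 0 b).domRestrict f), hf.domRestrict.Icc_extend',
      fun x hx => by rw [IccExtend_of_mem _ _ hx]; rfl⟩
  | succ r ih =>
    intro f hf
    push_cast at hf ⊢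
    have hu := uniqueDiffOn_Icc hb
    obtain ⟨hd, -, hf'⟩ := (contDiffOn_succ_iff_derivWithin hu).1 hf
    obtain ⟨G, hG, eG⟩ := ih _ hf'
    refine ⟨fun x => f 0 + ∫ s in (0:ℝ)..x, G s, ?_, ?_⟩
    · have hder : ∀ x, HasDerivAt (fun x => f 0 + ∫ s in (0:ℝ)..x, G s) (G x) x := fun x =>
        (hG.continuous.integral_hasStrictDerivAt 0 x).hasDerivAt.const_add _
      rw [contDiff_succ_iff_deriv]
      refine ⟨fun x => (hder x).differentiableAt, by simp, ?_⟩
      rwa [funext fun x => (hder x).deriv]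
    · intro x hx
      have h1 : ∫ s in (0:ℝ)..x, derivWithin f (Icc 0 b) s = f x - f 0 := by
        refine intervalIntegral.integral_eq_sub_of_hasDerivAt_of_le hx.1
          (hf.continuousOn.mono (Icc_subset_Icc_right hx.2)) (fun s hs => ?_) ?_
        · have hs' : s ∈ Icc 0 b := ⟨hs.1.le, hs.2.le.trans hx.2⟩
          exact ((hd s hs').hasDerivWithinAt).hasDerivAt
            (Icc_mem_nhds hs.1 (hs.2.trans_le hx.2))
        · refine ContinuousOn.intervalIntegrable ?_
          rw [uIcc_of_le hx.1]
          exact hf'.continuousOn.mono (Icc_subset_Icc_right hx.2)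
      have h2 : ∫ s in (0:ℝ)..x, G s = ∫ s in (0:ℝ)..x, derivWithin f (Icc 0 b) s := by
        refine intervalIntegral.integral_congr fun s hs => ?_
        rw [uIcc_of_le hx.1] at hs
        exact eG s ⟨hs.1, hs.2.trans hx.2⟩
      simp only [h2, h1]
      ring

lemma exists_ext_bdd (b : ℝ) (hb : 0 < b) (r : ℕ) (f : ℝ → ℂ) (hf : ContDiffOn ℝ r f (Icc 0 b)) :
    ∃ F : ℝ → ℂ, ContDiff ℝ r F ∧ (∀ x ∈ Icc 0 b, F x = f x) ∧ ∃ C, ∀ x, ‖F x‖ ≤ C := by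
  obtain ⟨F, hF, eF⟩ := exists_ext b hb r f hf
  let φ : ContDiffBump (0 : ℝ) := ⟨b, b + 1, hb, by linarith⟩
  have hs : ContDiff ℝ r (fun x => (φ x : ℝ) • F x) := φ.contDiff.smul hF
  refine ⟨fun x => (φ x : ℝ) • F x, hs, ?_, ?_⟩
  · intro x hx
    have : φ x = 1 := φ.one_of_mem_closedBall (by
      simp only [Metric.mem_closedBall, dist_zero_right, Real.norm_eq_abs, abs_of_nonneg hx.1]
      exact hx.2)
    simp [this, eF x hx]
  · exact (φ.hasCompactSupport.smul_right).exists_bound_of_continuous hs.continuous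

lemma contDiff_mat {E : Type*} [NormedAddCommGroup E] [NormedSpace ℝ E] (n : WithTop ℕ∞)
    (f₁ f₂ f₃ f₄ : E → ℂ) (h₁ : ContDiff ℝ n f₁) (h₂ : ContDiff ℝ n f₂) (h₃ : ContDiff ℝ n f₃)
    (h₄ : ContDiff ℝ n f₄) :
    ContDiff ℝ n (fun z => (!![f₁ z, f₂ z; f₃ z, f₄ z] : M2)) := by
  refine contDiff_pi.2 fun i => contDiff_pi.2 fun j => ?_
  fin_cases i <;> fin_cases j <;> simpa

lemma hasDerivAt_mat (f₁ f₂ f₃ f₄ : ℝ → ℂ) (d₁ d₂ d₃ d₄ : ℂ) (x : ℝ)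
    (h₁ : HasDerivAt f₁ d₁ x) (h₂ : HasDerivAt f₂ d₂ x) (h₃ : HasDerivAt f₃ d₃ x)
    (h₄ : HasDerivAt f₄ d₄ x) :
    HasDerivAt (fun z => (!![f₁ z, f₂ z; f₃ z, f₄ z] : M2)) (!![d₁, d₂; d₃, d₄] : M2) x := by
  refine hasDerivAt_pi.2 fun i => hasDerivAt_pi.2 fun j => ?_
  fin_cases i <;> fin_cases j <;> simpa

/-- Derivatives in the characteristic coordinates. -/
lemma char_derivs (F : ℝ → ℝ → ℂ) (hF : ContDiff ℝ 1 (fun z : ℝ × ℝ => F z.1 z.2)) (x t : ℝ) :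
    ∃ D₁ D₂ : ℂ,
      HasDerivAt (fun s => F ((s + t) / 2) ((s - t) / 2)) ((D₁ + D₂) / 2) x ∧
      HasDerivAt (fun s => F ((x + s) / 2) ((x - s) / 2)) ((D₁ - D₂) / 2) t ∧
      HasDerivAt (fun s => F s ((x - t) / 2)) D₁ ((x + t) / 2) ∧
      HasDerivAt (fun s => F ((x + t) / 2) s) D₂ ((x - t) / 2) := by
  set u := (x + t) / 2 with hu
  set v := (x - t) / 2 with hv
  obtain ⟨L, hL⟩ : ∃ L, HasFDerivAt (fun z : ℝ × ℝ => F z.1 z.2) L (u, v) :=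
    ⟨_, (hF.differentiable (by simp)).differentiableAt.hasFDerivAt⟩
  have key : ∀ α β : ℝ, L (α, β) = α * L (1, 0) + β * L (0, 1) := by
    intro α β
    have : ((α, β) : ℝ × ℝ) = α • ((1 : ℝ), (0 : ℝ)) + β • ((0 : ℝ), (1 : ℝ)) := by
      ext <;> simp
    rw [this, map_add, map_smul, map_smul]
    simp
  refine ⟨L (1, 0), L (0, 1), ?_, ?_, ?_, ?_⟩
  · have h : HasDerivAt (fun s : ℝ => ((s + t) / 2, (s - t) / 2)) ((1 / 2 : ℝ), (1 / 2 : ℝ)) x :=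
      (((hasDerivAt_id x).add_const t).div_const 2).prodMk
        (((hasDerivAt_id x).sub_const t).div_const 2)
    refine (hL.comp_hasDerivAt x h).congr_deriv ?_
    rw [key]; push_cast; ring
  · have h : HasDerivAt (fun s : ℝ => ((x + s) / 2, (x - s) / 2)) ((1 / 2 : ℝ), (-1 / 2 : ℝ)) t :=
      (((hasDerivAt_id t).const_add x).div_const 2).prodMk
        (((hasDerivAt_id t).const_sub x).div_const 2)
    refine (hL.comp_hasDerivAt t h).congr_deriv ?_
    rw [key]; push_cast; ring
  · exact hL.comp_hasDerivAt u ((hasDerivAt_id u).prodMk (hasDerivAt_const u v))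
  · exact hL.comp_hasDerivAt v ((hasDerivAt_const v u).prodMk (hasDerivAt_id v))

lemma exists_system (r : ℕ) (hr : 1 ≤ r) (w₁ w₂ : ℝ → ℂ) (M : ℝ) (hM : 0 < M)
    (h₁ : ContDiff ℝ r w₁) (h₂ : ContDiff ℝ r w₂)
    (b₁ : ∀ x, ‖w₁ x‖ ≤ M) (b₂ : ∀ x, ‖w₂ x‖ ≤ M) :
    ∃ a c : ℝ → ℝ → ℂ,
      ContDiff ℝ r (fun z : ℝ × ℝ => a ((z.1 + z.2) / 2) ((z.1 - z.2) / 2)) ∧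
      ContDiff ℝ r (fun z : ℝ × ℝ => c ((z.1 + z.2) / 2) ((z.1 - z.2) / 2)) ∧
      (∀ y, a 0 y = 0) ∧ (∀ x, c x 0 = w₂ x / 2) ∧
      (∀ x t, ∃ D : ℂ,
        HasDerivAt (fun s => a ((s + t) / 2) ((s - t) / 2))
          ((w₁ x * c ((x + t) / 2) ((x - t) / 2) + D) / 2) x ∧
        HasDerivAt (fun s => a ((x + s) / 2) ((x - s) / 2))
          ((w₁ x * c ((x + t) / 2) ((x - t) / 2) - D) / 2) t) ∧
      (∀ x t, ∃ D : ℂ,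
        HasDerivAt (fun s => c ((s + t) / 2) ((s - t) / 2))
          ((D + w₂ x * a ((x + t) / 2) ((x - t) / 2)) / 2) x ∧
        HasDerivAt (fun s => c ((x + s) / 2) ((x - s) / 2))
          ((D - w₂ x * a ((x + t) / 2) ((x - t) / 2)) / 2) t) := by
  obtain ⟨a, c, ca, cc, ea, ec⟩ := exists_sol w₁ w₂ (fun _ => 0) (fun x => w₂ x / 2) M hM
    h₁.continuous h₂.continuous continuous_const (h₂.continuous.div_const 2) b₁ b₂
    (fun x => by simpa using hM.le) (fun x => by
      rw [norm_div]
      have := b₂ x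
      simp only [Complex.norm_ofNat]
      linarith)
  obtain ⟨⟨ha, hc⟩, dax, dcx⟩ := regularity r a c w₁ w₂ _ _ h₁ h₂ contDiff_const
    (h₂.div_const 2) ca cc ea ec
  have hc' : ContDiff ℝ r (fun z : ℝ × ℝ => c z.2 z.1) :=
    hc.comp (contDiff_snd.prodMk contDiff_fst)
  have hch : ContDiff ℝ r (fun z : ℝ × ℝ => ((z.1 + z.2) / 2, (z.1 - z.2) / 2)) :=
    ((contDiff_fst.add contDiff_snd).div_const 2).prodMk
      ((contDiff_fst.sub contDiff_snd).div_const 2)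
  have h1r : (1 : WithTop ℕ∞) ≤ r := by exact_mod_cast hr
  refine ⟨a, fun x y => c y x, ha.comp hch, hc'.comp hch, ?_, ?_, ?_, ?_⟩
  · intro y; rw [ea]; simp
  · intro x; simp only [ec]; simp
  · intro x t
    obtain ⟨D₁, D₂, e1, e2, e3, e4⟩ := char_derivs a (ha.of_le h1r) x t
    have := e3.unique (dax _ _)
    rw [show (x + t) / 2 + (x - t) / 2 = x by ring] at this
    rw [this] at e1 e2
    exact ⟨D₂, e1, e2⟩
  · intro x t
    obtain ⟨D₁, D₂, e1, e2, e3, e4⟩ := char_derivs (fun x y => c y x) (hc'.of_le h1r) x t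
    have := e4.unique (dcx _ _)
    rw [show (x - t) / 2 + (x + t) / 2 = x by ring] at this
    rw [this] at e1 e2
    exact ⟨D₁, e1, e2⟩

/-- existence of a `C^r` transmutation kernel for a `C^r` potential. -/
theorem statement1 (b : ℝ) (hb : 0 < b) (r : ℕ) (hr : 1 ≤ r) (p q : ℝ → ℂ)
    (hQ : ContDiffOn ℝ r (diracPot p q) (Set.Icc 0 b)) :
    ∃ K : ℝ → ℝ → M2,
      ContDiffOn ℝ r (fun z : ℝ × ℝ => K z.1 z.2) (OmegaPlus b) ∧
      IsTransKernel b (diracPot p q) K := by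
  have hp : ContDiffOn ℝ r p (Icc 0 b) := by
    have := contDiffOn_pi.1 (contDiffOn_pi.1 hQ 0) 0
    simpa [diracPot] using this
  have hq : ContDiffOn ℝ r q (Icc 0 b) := by
    have := contDiffOn_pi.1 (contDiffOn_pi.1 hQ 0) 1
    simpa [diracPot] using this
  obtain ⟨P, cP, eP, CP, bP⟩ := exists_ext_bdd b hb r p hp
  obtain ⟨Q, cQ, eQ, CQ, bQ⟩ := exists_ext_bdd b hb r q hq
  have hCP : 0 ≤ CP := (norm_nonneg _).trans (bP 0)
  have hCQ : 0 ≤ CQ := (norm_nonneg _).trans (bQ 0)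
  have k₁ : ContDiff ℝ r (fun x => Q x + Complex.I * P x) := cQ.add (contDiff_const.mul cP)
  have k₂ : ContDiff ℝ r (fun x => Q x - Complex.I * P x) := cQ.sub (contDiff_const.mul cP)
  have l₁ : ∀ x, ‖Q x + Complex.I * P x‖ ≤ CQ + CP + 1 := fun x => by
    refine (norm_add_le _ _).trans ?_
    rw [norm_mul, Complex.norm_I, one_mul]
    linarith [bP x, bQ x]
  have l₂ : ∀ x, ‖Q x - Complex.I * P x‖ ≤ CQ + CP + 1 := fun x => by
    refine (norm_sub_le _ _).trans ?_
    rw [norm_mul, Complex.norm_I, one_mul]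
    linarith [bP x, bQ x]
  obtain ⟨a₁, c₁, sa₁, sc₁, za₁, zc₁, da₁, dc₁⟩ := exists_system r hr _ _ (CQ + CP + 1)
    (by linarith) k₁ k₂ l₁ l₂
  obtain ⟨a₂, c₂, sa₂, sc₂, za₂, zc₂, da₂, dc₂⟩ := exists_system r hr _ _ (CQ + CP + 1)
    (by linarith) k₂ k₁ l₂ l₁
  set J : ℂ := -Complex.I / 2 with hJ
  let κ : (ℝ → ℝ → ℂ) → ℝ → ℝ → ℂ := fun f x t => f ((x + t) / 2) ((x - t) / 2)
  refine ⟨fun x t => !![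
    (1 / 2) * (κ a₁ x t + κ a₂ x t) + (1 / 2) * (κ c₁ x t + κ c₂ x t),
    J * (κ a₁ x t - κ a₂ x t) + J * (κ c₁ x t - κ c₂ x t);
    J * (κ c₁ x t - κ c₂ x t) - J * (κ a₁ x t - κ a₂ x t),
    (1 / 2) * (κ a₁ x t + κ a₂ x t) - (1 / 2) * (κ c₁ x t + κ c₂ x t)], ?_, ?_, ?_, ?_⟩
  · refine ContDiff.contDiffOn (contDiff_mat _ _ _ _ _ ?_ ?_ ?_ ?_)
    · exact (contDiff_const.mul (sa₁.add sa₂)).add (contDiff_const.mul (sc₁.add sc₂))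
    · exact (contDiff_const.mul (sa₁.sub sa₂)).add (contDiff_const.mul (sc₁.sub sc₂))
    · exact (contDiff_const.mul (sc₁.sub sc₂)).sub (contDiff_const.mul (sa₁.sub sa₂))
    · exact (contDiff_const.mul (sa₁.add sa₂)).sub (contDiff_const.mul (sc₁.add sc₂))
  · intro x t hxt
    have hx : x ∈ Icc 0 b := ⟨hxt.1, hxt.2.1⟩
    obtain ⟨A₁, ax₁, at₁⟩ := da₁ x t
    obtain ⟨A₂, ax₂, at₂⟩ := da₂ x t
    obtain ⟨C₁, cx₁, ct₁⟩ := dc₁ x t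
    obtain ⟨C₂, cx₂, ct₂⟩ := dc₂ x t
    have hX := hasDerivAt_mat _ _ _ _ _ _ _ _ x
      (((ax₁.add ax₂).const_mul (1 / 2)).add ((cx₁.add cx₂).const_mul (1 / 2)))
      (((ax₁.sub ax₂).const_mul J).add ((cx₁.sub cx₂).const_mul J))
      (((cx₁.sub cx₂).const_mul J).sub ((ax₁.sub ax₂).const_mul J))
      (((ax₁.add ax₂).const_mul (1 / 2)).sub ((cx₁.add cx₂).const_mul (1 / 2)))
    have hT := hasDerivAt_mat _ _ _ _ _ _ _ _ t
      (((at₁.add at₂).const_mul (1 / 2)).add ((ct₁.add ct₂).const_mul (1 / 2)))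
      (((at₁.sub at₂).const_mul J).add ((ct₁.sub ct₂).const_mul J))
      (((ct₁.sub ct₂).const_mul J).sub ((at₁.sub at₂).const_mul J))
      (((at₁.add at₂).const_mul (1 / 2)).sub ((ct₁.add ct₂).const_mul (1 / 2)))
    have eX := hX.deriv
    have eT := hT.deriv
    refine (congrArg₂ (fun U V => Bmat * U + V * Bmat) eX eT).trans ?_
    simp only [diracPot, ← eP x hx, ← eQ x hx, κ]
    generalize a₁ ((x + t) / 2) ((x - t) / 2) = α₁
    generalize a₂ ((x + t) / 2) ((x - t) / 2) = α₂
    generalize c₁ ((x + t) / 2) ((x - t) / 2) = γ₁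
    generalize c₂ ((x + t) / 2) ((x - t) / 2) = γ₂
    have hI := Complex.I_sq
    ext i j
    fin_cases i <;> fin_cases j <;>
      simp [Bmat, hJ, Matrix.mul_apply, Fin.sum_univ_two] <;> ring_nf <;>
      simp only [Complex.I_sq] <;> ring
  · intro x hx
    simp only [κ, diracPot, ← eP x hx, ← eQ x hx, sub_self, zero_div, add_self_div_two, zc₁, zc₂]
    ext i j
    fin_cases i <;> fin_cases j <;>
      simp [Bmat, hJ, Matrix.mul_apply, Fin.sum_univ_two] <;> ring_nf <;>
      simp only [Complex.I_sq] <;> ring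
  · intro x hx
    simp only [κ, add_neg_cancel, zero_div, za₁, za₂]
    ext i j
    fin_cases i <;> fin_cases j <;>
      simp [Bmat, hJ, Matrix.mul_apply, Fin.sum_univ_two]

end
end

section
/- Let Q be a Dirac potential on [0,b] with continuously differentiable entries and let K be a continuously differentiable transmutation kernel for Q, with Fourier–Legendre coefficients K_n; set θ_n(x) := xⁿ·K_n(x). Then θ₀(x) = (U(0,x) − I)/2 and θ_{−1}(x) := −K₀(x)/x = −(U(0,x) − I)/(2x), and for every integer n ≥ 1 and x ∈ [0,b]: θ_n(x) = ((2n+1)/(2n−3))·[ x²·θ_{n−2}(x) + S[ t ↦ −(2n−1)·t·B·θ_{n−2}(t) + (2n−3)·θ_{n−1}(t)·B ](x) ]. -/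
noncomputable section

open MeasureTheory Set Filter Topology Polynomial intervalIntegral

attribute [local instance] Matrix.normedAddCommGroup Matrix.normedSpace

theorem leg_zero : legendreP 0 = 1 := by simp [legendreP]

theorem leg_one : legendreP 1 = X := by
  have h : C (2⁻¹:ℝ) * (1 + 1) = 1 := by
    rw [← C_1, ← C_add, ← C_mul]; norm_num
  simp [legendreP, smul_eq_C_mul, ← mul_assoc]; exact h

theorem leg_eq (n : ℕ) : legendreP n =
    C ((2 ^ n * n.factorial : ℝ)⁻¹) * derivative^[n] ((X ^ 2 - 1 : Polynomial ℝ) ^ n) := by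
  rw [legendreP, smul_eq_C_mul]

theorem leg_a (n : ℕ) : derivative (legendreP (n+1)) =
    X * derivative (legendreP n) + C ((n:ℝ)+1) * legendreP n := by
  have h1 : derivative ((X ^ 2 - 1 : Polynomial ℝ) ^ (n+1)) =
      C (2 * ((n:ℝ)+1)) * (X * (X ^ 2 - 1 : Polynomial ℝ) ^ n) := by
    rw [derivative_pow_succ]
    simp [C_ofNat]
    ring
  have h2 : ∀ (m : ℕ) (r : Polynomial ℝ), derivative^[m+1] (X * r) =
      X * derivative^[m+1] r + C ((m:ℝ)+1) * derivative^[m] r := by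
    intro m r
    induction m with
    | zero => simp; ring
    | succ m ih =>
      rw [Function.iterate_succ_apply', ih]
      simp only [derivative_add, derivative_mul, derivative_X, derivative_C,
        ← Function.iterate_succ_apply' derivative]
      push_cast
      simp only [C_add, C_1]
      ring
  have hc : ((2 ^ (n+1) * (n+1).factorial : ℝ)⁻¹) * (2 * ((n:ℝ)+1)) = (2 ^ n * n.factorial : ℝ)⁻¹ := by
    have : (n.factorial : ℝ) ≠ 0 := by positivity
    have : (n:ℝ)+1 ≠ 0 := by positivity
    rw [Nat.factorial_succ]; push_cast; field_simp; ring
  rw [leg_eq, leg_eq, derivative_C_mul, ← Function.iterate_succ_apply' derivative,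
    Function.iterate_succ_apply, h1, iterate_derivative_C_mul, h2, ← mul_assoc, ← C_mul, hc,
    derivative_C_mul, ← Function.iterate_succ_apply' derivative]
  ring

theorem leg_b (n : ℕ) : derivative (legendreP (n+2)) =
    derivative (legendreP n) + C (2*(n:ℝ)+3) * legendreP (n+1) := by
  have h1 : derivative (derivative ((X ^ 2 - 1 : Polynomial ℝ) ^ (n+2))) =
      C (2 * ((n:ℝ)+2) * (2*(n:ℝ)+3)) * ((X ^ 2 - 1 : Polynomial ℝ) ^ (n+1)) +
      C (2 * ((n:ℝ)+2) * (2*((n:ℝ)+1))) * ((X ^ 2 - 1 : Polynomial ℝ) ^ n) := by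
    rw [derivative_pow_succ, derivative_mul, derivative_C_mul, derivative_pow_succ]
    simp [C_ofNat]
    ring
  have hc : ((2 ^ (n+2) * (n+2).factorial : ℝ)⁻¹) * (2 * ((n:ℝ)+2) * (2*(n:ℝ)+3)) =
      (2*(n:ℝ)+3) * (2 ^ (n+1) * (n+1).factorial : ℝ)⁻¹ := by
    have : ((n+1).factorial : ℝ) ≠ 0 := by positivity
    have : (n:ℝ)+2 ≠ 0 := by positivity
    rw [Nat.factorial_succ (n+1)]; push_cast; field_simp; ring
  have hc2 : ((2 ^ (n+2) * (n+2).factorial : ℝ)⁻¹) * (2 * ((n:ℝ)+2) * (2*((n:ℝ)+1))) =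
      (2 ^ n * n.factorial : ℝ)⁻¹ := by
    have : (n.factorial : ℝ) ≠ 0 := by positivity
    have : (n:ℝ)+2 ≠ 0 := by positivity
    have : (n:ℝ)+1 ≠ 0 := by positivity
    rw [Nat.factorial_succ (n+1), Nat.factorial_succ n]; push_cast; field_simp; ring
  rw [leg_eq, leg_eq, leg_eq, derivative_C_mul, ← Function.iterate_succ_apply' derivative,
    Function.iterate_succ_apply, Function.iterate_succ_apply, h1, iterate_map_add,
    iterate_derivative_C_mul, iterate_derivative_C_mul, mul_add, ← mul_assoc, ← C_mul, hc,
    ← mul_assoc, ← C_mul, hc2, derivative_C_mul, ← Function.iterate_succ_apply' derivative,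
    ← mul_assoc, ← C_mul]
  ring

theorem leg_c (n : ℕ) : C ((n:ℝ)+2) * (legendreP (n+2) - legendreP n)
    - X * derivative (legendreP (n+2) - legendreP n) = - (C (2*(n:ℝ)+3) * legendreP n) := by
  have a1 := leg_a n
  have a2 := leg_a (n+1)
  have b1 := leg_b n
  have b2 := leg_b (n+1)
  have a3 := leg_a (n+2)
  simp only [derivative_sub]
  push_cast at *
  simp only [C_add, C_mul, C_1, C_ofNat] at *
  rw [show n + 1 + 2 = n + 2 + 1 from rfl, show n + 1 + 1 = n + 2 from rfl] at b2
  linear_combination a3 - b2 - a1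

theorem leg_at_one (n : ℕ) : (legendreP n).eval 1 = 1 := by
  have key : ∀ n, (legendreP n).eval 1 = 1 ∧ (legendreP (n+1)).eval 1 = 1 := by
    intro n
    induction n with
    | zero => simp [leg_zero, leg_one]
    | succ n ih =>
      refine ⟨ih.2, ?_⟩
      have h := congrArg (eval 1) (leg_c n)
      rw [derivative_sub, leg_b] at h
      simp [ih.1, ih.2] at h
      have : (n:ℝ)+2 ≠ 0 := by positivity
      have h2 : ((n:ℝ)+2) * ((legendreP (n+2)).eval 1 - 1) = 0 := by linarith
      have := (mul_eq_zero.1 h2).resolve_left this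
      show (legendreP (n+2)).eval 1 = 1
      linarith
  exact (key n).1

theorem hd_iff {F : ℝ → M2} {F' : M2} {x : ℝ} :
    HasDerivAt F F' x ↔ ∀ i j, HasDerivAt (fun y => F y i j) (F' i j) x := by
  constructor
  · intro h i j
    exact hasDerivAt_pi.1 (hasDerivAt_pi.1 h i) j
  · intro h
    exact hasDerivAt_pi.2 fun i => hasDerivAt_pi.2 fun j => h i j

theorem hdw_iff {F : ℝ → M2} {F' : M2} {x : ℝ} {s : Set ℝ}:
    HasDerivWithinAt F F' s x ↔ ∀ i j, HasDerivWithinAt (fun y => F y i j) (F' i j) s x := by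
  constructor
  · intro h i j
    exact hasDerivWithinAt_pi.1 (hasDerivWithinAt_pi.1 h i) j
  · intro h
    exact hasDerivWithinAt_pi.2 fun i => hasDerivWithinAt_pi.2 fun j => h i j

theorem U_rel {b : ℝ} {p q : ℝ → ℂ} {U U' : ℝ → M2}
    (hUode : ∀ x ∈ Set.Icc 0 b, Bmat * U' x + diracPot p q x * U x = 0) {x : ℝ}
    (hx : x ∈ Icc 0 b) (j : Fin 2) :
    U' x 0 j = q x * U x 0 j - p x * U x 1 j ∧ U' x 1 j = -(p x * U x 0 j + q x * U x 1 j) := by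
  have h := hUode x hx
  have h0 := congrFun (congrFun h 0) j
  have h1 := congrFun (congrFun h 1) j
  rw [Matrix.add_apply, Matrix.mul_apply, Matrix.mul_apply, Fin.sum_univ_two,
    Fin.sum_univ_two] at h0 h1
  simp [Bmat, diracPot] at h0 h1
  constructor
  · linear_combination -h1
  · linear_combination h0

theorem U_det {b : ℝ} {p q : ℝ → ℂ} {U U' : ℝ → M2} (hU0 : U 0 = 1)
    (hUd : ∀ x ∈ Set.Icc 0 b, HasDerivWithinAt U (U' x) (Set.Icc 0 b) x)
    (hUode : ∀ x ∈ Set.Icc 0 b, Bmat * U' x + diracPot p q x * U x = 0) {x : ℝ}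
    (hx : x ∈ Icc 0 b) : (U x).det = 1 := by
  have hd : ∀ x ∈ Icc 0 b, HasDerivWithinAt (fun y => (U y).det) 0 (Icc 0 b) x := by
    intro x hx
    have h := hdw_iff.1 (hUd x hx)
    have := ((h 0 0).mul (h 1 1)).sub ((h 0 1).mul (h 1 0))
    simp only [Matrix.det_fin_two]
    refine this.congr_deriv ?_
    have r0 := U_rel hUode hx 0
    have r1 := U_rel hUode hx 1
    rw [r0.1, r0.2, r1.1, r1.2]; ring
  have := constant_of_derivWithin_zero (f := fun y => (U y).det) (a := 0) (b := b)
    (fun x hx => (hd x hx).differentiableWithinAt) (fun x hx => by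
      have hx' : x ∈ Icc 0 b := ⟨hx.1, hx.2.le⟩
      exact (hd x hx').derivWithin ((uniqueDiffOn_Icc (hx.1.trans_lt hx.2)) x hx')) x hx
  simp only [this, hU0, Matrix.det_one]

theorem ode_solve {b : ℝ} {p q : ℝ → ℂ} {U U' : ℝ → M2} (hU0 : U 0 = 1)
    (hUd : ∀ x ∈ Set.Icc 0 b, HasDerivWithinAt U (U' x) (Set.Icc 0 b) x)
    (hUode : ∀ x ∈ Set.Icc 0 b, Bmat * U' x + diracPot p q x * U x = 0)
    {G H : ℝ → M2} (hG : ContinuousOn G (Icc 0 b)) (hG0 : G 0 = 0) (hH : ContinuousOn H (Icc 0 b))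
    (hode : ∀ x ∈ Ioo 0 b, ∃ G', HasDerivAt G G' x ∧ Bmat * G' + diracPot p q x * G x = H x)
    {x : ℝ} (hx : x ∈ Icc 0 b) : G x = Sop U H x := by
  have hsub : Icc 0 x ⊆ Icc 0 b := Icc_subset_Icc_right hx.2
  have hUc : ContinuousOn U (Icc 0 b) := fun y hy => (hUd y hy).continuousWithinAt
  have hadj : ContinuousOn (fun y => (U y).adjugate) (Icc 0 b) :=
    
    Continuous.comp_continuousOn (g := fun A : M2 => A.adjugate)
      (Continuous.matrix_adjugate continuous_id) hUc
  have key := integral_eq_sub_of_hasDerivAt_of_le (a := 0) (b := x)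
    (f := fun y => (U y).adjugate * G y)
    (f' := fun y => (U y).adjugate * Bmat.transpose * H y) hx.1
    ((hadj.mul hG).mono hsub) (fun y hy => by
      have hy' : y ∈ Ioo 0 b := ⟨hy.1, hy.2.trans_le hx.2⟩
      have hyc : y ∈ Icc 0 b := ⟨hy'.1.le, hy'.2.le⟩
      obtain ⟨G', hG', hE⟩ := hode y hy'
      have hu := hd_iff.1 ((hUd y hyc).hasDerivAt (Icc_mem_nhds hy'.1 hy'.2))
      have hg := hd_iff.1 hG'
      rw [← hE]
      refine hd_iff.2 ?_
      have r0 := U_rel hUode hyc 0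
      have r1 := U_rel hUode hyc 1
      intro i j
      fin_cases i
      · simp only [Matrix.adjugate_fin_two, Matrix.mul_apply, Fin.sum_univ_two]
        have := ((hu 1 1).mul (hg 0 j)).add (((hu 0 1).neg).mul (hg 1 j))
        refine (this.congr_deriv ?_).congr_of_eventuallyEq (.of_forall fun z => by simp)
        simp only [Matrix.add_apply, Matrix.mul_apply, Fin.sum_univ_two]
        simp [Bmat, diracPot]
        rw [r1.1, r1.2]; ring
      · simp only [Matrix.adjugate_fin_two, Matrix.mul_apply, Fin.sum_univ_two]
        have := (((hu 1 0).neg).mul (hg 0 j)).add ((hu 0 0).mul (hg 1 j))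
        refine (this.congr_deriv ?_).congr_of_eventuallyEq (.of_forall fun z => by simp)
        simp only [Matrix.add_apply, Matrix.mul_apply, Fin.sum_univ_two]
        simp [Bmat, diracPot]
        rw [r0.1, r0.2]; ring)
    (by
      apply ContinuousOn.intervalIntegrable
      rw [uIcc_of_le hx.1]
      exact ((hadj.mul continuousOn_const).mul hH).mono hsub)
  have e : ∫ t in (0 : ℝ)..x, (U t)⁻¹ * Bmat.transpose * H t =
      ∫ t in (0 : ℝ)..x, (U t).adjugate * Bmat.transpose * H t := by
    apply intervalIntegral.integral_congr
    intro t ht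
    rw [uIcc_of_le hx.1] at ht
    simp only [Matrix.inv_def, U_det hU0 hUd hUode (hsub ht), Ring.inverse_one, one_smul]
  rw [Sop, e, key, hG0, mul_zero, sub_zero, ← mul_assoc, Matrix.mul_adjugate,
    U_det hU0 hUd hUode hx, one_smul, one_mul]

/-- Rescaled moment of the kernel against a polynomial. -/
def Iop {E : Type*} [NormedAddCommGroup E] [NormedSpace ℝ E]
    (K : ℝ → ℝ → E) (r : Polynomial ℝ) (x : ℝ) : E :=
  ∫ s in (-1 : ℝ)..1, r.eval s • K x (x * s)

theorem mem_Omega {b x s : ℝ} (hx : x ∈ Icc 0 b) (hs : s ∈ Icc (-1 : ℝ) 1) :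
    (x, x * s) ∈ OmegaPlus b := by
  refine ⟨hx.1, hx.2, ?_⟩
  have : |s| ≤ 1 := abs_le.2 hs
  simp only [abs_mul, abs_of_nonneg hx.1]
  nlinarith [hx.1]

theorem Omega_nhds {b x s : ℝ} (hx : x ∈ Ioo 0 b) (hs : s ∈ Ioo (-1 : ℝ) 1) :
    OmegaPlus b ∈ 𝓝 (x, x * s) := by
  have h1 : IsOpen {z : ℝ × ℝ | 0 < z.1 ∧ z.1 < b ∧ |z.2| < z.1} :=
    (isOpen_lt continuous_const continuous_fst).inter
      ((isOpen_lt continuous_fst continuous_const).inter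
        (isOpen_lt continuous_snd.abs continuous_fst))
  refine mem_of_superset (h1.mem_nhds ⟨hx.1, hx.2, ?_⟩) fun z hz => ⟨hz.1.le, hz.2.1.le, hz.2.2.le⟩
  have : |s| < 1 := abs_lt.2 hs
  simp only [abs_mul, abs_of_pos hx.1]
  nlinarith [hx.1]

theorem Omega_compact (b : ℝ) : IsCompact (OmegaPlus b) := by
  refine IsCompact.of_isClosed_subset (isCompact_Icc (a := ((0 : ℝ), -b)) (b := (b, b))) ?_ ?_
  · exact (isClosed_le continuous_const continuous_fst).inter
      ((isClosed_le continuous_fst continuous_const).inter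
        (isClosed_le continuous_snd.abs continuous_fst))
  · rintro ⟨x, t⟩ ⟨h1, h2, h3⟩
    have := abs_le.1 h3
    simp only at *
    exact ⟨⟨h1, by simp only; linarith⟩, ⟨h2, by simp only; linarith⟩⟩

theorem Omega_unique {b : ℝ} (hb : 0 < b) : UniqueDiffOn ℝ (OmegaPlus b) := by
  apply uniqueDiffOn_convex
  · rintro ⟨x, t⟩ ⟨h1, h2, h3⟩ ⟨y, u⟩ ⟨g1, g2, g3⟩ α β hα hβ hαβ
    simp only [OmegaPlus, Prod.smul_mk, Prod.mk_add_mk, smul_eq_mul, mem_ofPred_eq] at *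
    have := abs_le.1 h3
    have := abs_le.1 g3
    have hβ' : β = 1 - α := by linarith
    refine ⟨by positivity, ?_, ?_⟩
    · subst hβ'; nlinarith
    · rw [abs_le]; constructor <;> nlinarith
  · refine ⟨(b/2, b/2*0), mem_interior_iff_mem_nhds.2 (Omega_nhds ⟨by linarith, by linarith⟩ ?_)⟩
    norm_num

section kern

variable {E : Type*} [NormedAddCommGroup E] [NormedSpace ℝ E]
  {b : ℝ} {K : ℝ → ℝ → E}

/-- The derivative of the kernel within the triangle. -/
def Dk (b : ℝ) (K : ℝ → ℝ → E) : ℝ × ℝ → (ℝ × ℝ →L[ℝ] E) :=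
  fderivWithin ℝ (fun z : ℝ × ℝ => K z.1 z.2) (OmegaPlus b)

theorem Dk_cont (hb : 0 < b) (hK : ContDiffOn ℝ 1 (fun z : ℝ × ℝ => K z.1 z.2) (OmegaPlus b)) :
    ContinuousOn (Dk b K) (OmegaPlus b) :=
  hK.continuousOn_fderivWithin (Omega_unique hb) le_rfl

theorem Dk_has (hK : ContDiffOn ℝ 1 (fun z : ℝ × ℝ => K z.1 z.2) (OmegaPlus b))
    {x s : ℝ} (hx : x ∈ Ioo 0 b) (hs : s ∈ Ioo (-1 : ℝ) 1) :
    HasFDerivAt (fun z : ℝ × ℝ => K z.1 z.2) (Dk b K (x, x * s)) (x, x * s) := by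
  have hm : (x, x * s) ∈ OmegaPlus b := mem_of_mem_nhds (Omega_nhds hx hs)
  exact ((hK.differentiableOn one_ne_zero) _ hm).hasFDerivWithinAt.hasFDerivAt (Omega_nhds hx hs)

theorem k_cont_s (hK : ContDiffOn ℝ 1 (fun z : ℝ × ℝ => K z.1 z.2) (OmegaPlus b))
    {x : ℝ} (hx : x ∈ Icc 0 b) : ContinuousOn (fun s => K x (x * s)) (Icc (-1 : ℝ) 1) :=
  hK.continuousOn.comp (f := fun s : ℝ => (x, x * s)) (by fun_prop) fun _ hs => mem_Omega hx hs

theorem D_cont_s (hb : 0 < b)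
    (hK : ContDiffOn ℝ 1 (fun z : ℝ × ℝ => K z.1 z.2) (OmegaPlus b))
    {x : ℝ} (hx : x ∈ Icc 0 b) (v : ℝ × ℝ) :
    ContinuousOn (fun s => Dk b K (x, x * s) v) (Icc (-1 : ℝ) 1) :=
  ((Dk_cont hb hK).comp (f := fun s : ℝ => (x, x * s)) (by fun_prop)
    fun _ hs => mem_Omega hx hs).clm_apply continuousOn_const

theorem ii_of {f : ℝ → E} (h : ContinuousOn f (Icc (-1 : ℝ) 1)) (r : Polynomial ℝ) :
    IntervalIntegrable (fun s => r.eval s • f s) volume (-1) 1 := by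
  apply ContinuousOn.intervalIntegrable
  rw [uIcc_of_le (by norm_num)]
  exact r.continuous.continuousOn.smul h

theorem I_cont (hK : ContDiffOn ℝ 1 (fun z : ℝ × ℝ => K z.1 z.2) (OmegaPlus b))
    (r : Polynomial ℝ) : ContinuousOn (Iop K r) (Icc 0 b) := by
  obtain ⟨M, hM⟩ := (Omega_compact b).exists_bound_of_continuousOn hK.continuousOn
  intro x hx
  refine continuousWithinAt_of_dominated_interval (bound := fun s => |r.eval s| * M) ?_ ?_ ?_ ?_
  · filter_upwards [self_mem_nhdsWithin] with y hy
    have := (ii_of (k_cont_s hK hy) r).def'.aestronglyMeasurable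
    exact this
  · filter_upwards [self_mem_nhdsWithin] with y hy
    refine Eventually.of_forall fun s hs => ?_
    rw [uIoc_of_le (by norm_num)] at hs
    rw [norm_smul, Real.norm_eq_abs]
    exact mul_le_mul_of_nonneg_left (hM (y, y * s) (mem_Omega hy ⟨hs.1.le, hs.2⟩)) (abs_nonneg _)
  · exact (Continuous.mul r.continuous.abs continuous_const).intervalIntegrable _ _
  · refine Eventually.of_forall fun s hs => ?_
    rw [uIoc_of_le (by norm_num)] at hs
    refine ContinuousWithinAt.smul continuousWithinAt_const ?_
    exact (hK.continuousOn.comp (f := fun y : ℝ => (y, y * s)) (by fun_prop)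
      fun y hy => mem_Omega hy ⟨hs.1.le, hs.2⟩) x hx

theorem ae_ioo : ∀ᵐ s : ℝ, s ∈ uIoc (-1 : ℝ) 1 → s ∈ Ioo (-1 : ℝ) 1 := by
  have : ∀ᵐ s : ℝ, s ≠ 1 := by
    rw [ae_iff]; simp
  filter_upwards [this] with s hs h
  rw [uIoc_of_le (by norm_num)] at h
  exact ⟨h.1, lt_of_le_of_ne h.2 hs⟩

theorem I_deriv (hb : 0 < b)
    (hK : ContDiffOn ℝ 1 (fun z : ℝ × ℝ => K z.1 z.2) (OmegaPlus b))
    (r : Polynomial ℝ) {x : ℝ} (hx : x ∈ Ioo 0 b) :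
    HasDerivAt (Iop K r) (∫ s in (-1 : ℝ)..1, r.eval s • Dk b K (x, x * s) (1, s)) x := by
  obtain ⟨M, hM⟩ := (Omega_compact b).exists_bound_of_continuousOn (Dk_cont hb hK)
  have hxc : x ∈ Icc 0 b := ⟨hx.1.le, hx.2.le⟩
  refine (intervalIntegral.hasDerivAt_integral_of_dominated_loc_of_deriv_le
    (F := fun y s => r.eval s • K y (y * s))
    (F' := fun y s => r.eval s • Dk b K (y, y * s) (1, s))
    (bound := fun s => |r.eval s| * (M * 1)) (Ioo_mem_nhds hx.1 hx.2) ?_ ?_ ?_ ?_ ?_ ?_).2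
  · filter_upwards [Ioo_mem_nhds hx.1 hx.2] with y hy
    exact (ii_of (k_cont_s hK ⟨hy.1.le, hy.2.le⟩) r).def'.aestronglyMeasurable
  · exact ii_of (k_cont_s hK hxc) r
  · refine (ii_of (f := fun s => Dk b K (x, x * s) (1, s)) ?_ r).def'.aestronglyMeasurable
    exact ((Dk_cont hb hK).comp (f := fun s : ℝ => (x, x * s)) (by fun_prop)
      fun _ hs => mem_Omega hxc hs).clm_apply (by fun_prop)
  · refine Eventually.of_forall fun s hs y hy => ?_
    rw [uIoc_of_le (by norm_num)] at hs
    rw [norm_smul, Real.norm_eq_abs]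
    have hmem := mem_Omega (b := b) (x := y) (s := s) ⟨hy.1.le, hy.2.le⟩ ⟨hs.1.le, hs.2⟩
    refine mul_le_mul_of_nonneg_left ?_ (abs_nonneg _)
    refine (ContinuousLinearMap.le_opNorm _ _).trans ?_
    have h1 : ‖((1 : ℝ), s)‖ ≤ 1 := by
      rw [Prod.norm_mk]
      simp [abs_le, hs.1.le, hs.2]
    exact mul_le_mul (hM _ hmem) h1 (norm_nonneg _) ((norm_nonneg _).trans (hM _ hmem))
  · exact (Continuous.mul r.continuous.abs continuous_const).intervalIntegrable _ _
  · filter_upwards [ae_ioo] with s hs h y hy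
    refine HasDerivAt.const_smul _ ?_
    have hd : HasDerivAt (fun y : ℝ => (y, y * s)) (1, s) y := by
      have := (hasDerivAt_id y).prodMk ((hasDerivAt_id y).mul_const s)
      simpa using this
    exact (Dk_has hK hy (hs h)).comp_hasDerivAt y hd

theorem I_parts [CompleteSpace E] (hb : 0 < b)
    (hK : ContDiffOn ℝ 1 (fun z : ℝ × ℝ => K z.1 z.2) (OmegaPlus b))
    (r : Polynomial ℝ) {x : ℝ} (hx : x ∈ Ioo 0 b) :
    x • (∫ s in (-1 : ℝ)..1, r.eval s • Dk b K (x, x * s) (0, 1)) =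
      r.eval 1 • K x x - r.eval (-1) • K x (-x) - Iop K (derivative r) x := by
  have hxc : x ∈ Icc 0 b := ⟨hx.1.le, hx.2.le⟩
  have i1 := ii_of (k_cont_s hK hxc) (derivative r)
  have i2 := ii_of (D_cont_s hb hK hxc (0, 1)) r
  have key := integral_eq_sub_of_hasDerivAt_of_le (a := -1) (b := 1)
    (f := fun s => r.eval s • K x (x * s))
    (f' := fun s => (derivative r).eval s • K x (x * s) +
      x • (r.eval s • Dk b K (x, x * s) (0, 1))) (by norm_num)
    (r.continuous.continuousOn.smul (k_cont_s hK hxc))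
    (fun s hs => by
      have hd : HasDerivAt (fun y : ℝ => (x, x * y)) (0, x) s := by
        have := (hasDerivAt_const s x).prodMk ((hasDerivAt_id s).const_mul x)
        simpa using this
      have h2 := (Dk_has hK hx hs).comp_hasDerivAt s hd
      have h3 := (r.hasDerivAt s).smul h2
      refine h3.congr_deriv ?_
      have : ((0 : ℝ), x) = x • ((0 : ℝ), (1 : ℝ)) := by simp
      rw [this, map_smul, smul_comm, add_comm]
      rfl)
    (i1.add (i2.smul x))
  have i2' : IntervalIntegrable (fun s => x • (r.eval s • Dk b K (x, x * s) (0, 1)))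
    volume (-1) 1 := i2.smul x
  rw [intervalIntegral.integral_add i1 i2', intervalIntegral.integral_smul] at key
  simp only [mul_one, mul_neg] at key
  rw [← key, Iop]
  abel

theorem Dk_x (hK : ContDiffOn ℝ 1 (fun z : ℝ × ℝ => K z.1 z.2) (OmegaPlus b))
    {x s : ℝ} (hx : x ∈ Ioo 0 b) (hs : s ∈ Ioo (-1 : ℝ) 1) :
    deriv (fun y => K y (x * s)) x = Dk b K (x, x * s) (1, 0) := by
  have hd : HasDerivAt (fun y : ℝ => (y, x * s)) (1, 0) x :=
    (hasDerivAt_id x).prodMk (hasDerivAt_const x (x * s))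
  exact ((Dk_has hK hx hs).comp_hasDerivAt x hd).deriv

theorem Dk_t (hK : ContDiffOn ℝ 1 (fun z : ℝ × ℝ => K z.1 z.2) (OmegaPlus b))
    {x s : ℝ} (hx : x ∈ Ioo 0 b) (hs : s ∈ Ioo (-1 : ℝ) 1) :
    deriv (fun y => K x y) (x * s) = Dk b K (x, x * s) (0, 1) := by
  have hd : HasDerivAt (fun y : ℝ => (x, y)) (0, 1) (x * s) :=
    (hasDerivAt_const (x * s) x).prodMk (hasDerivAt_id (x * s))
  exact ((Dk_has hK hx hs).comp_hasDerivAt (x * s) hd).deriv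

theorem I_comb (hK : ContDiffOn ℝ 1 (fun z : ℝ × ℝ => K z.1 z.2) (OmegaPlus b))
    {x : ℝ} (hx : x ∈ Icc 0 b) (c : ℝ) (r₁ r₂ : Polynomial ℝ) :
    Iop K (C c * r₁ - r₂) x = c • Iop K r₁ x - Iop K r₂ x := by
  have i1 := ii_of (k_cont_s hK hx) r₁
  have i2 := ii_of (k_cont_s hK hx) r₂
  simp only [Iop, eval_sub, eval_mul, eval_C, sub_smul, mul_smul]
  have i1' : IntervalIntegrable (fun s => c • (r₁.eval s • K x (x * s)))
    volume (-1) 1 := i1.smul c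
  rw [intervalIntegral.integral_sub i1' i2, intervalIntegral.integral_smul]

theorem main_gen [FiniteDimensional ℝ E] (BL BR : E →ₗ[ℝ] E) (QL : ℝ → E →ₗ[ℝ] E) (qv : ℝ → E)
    (hb : 0 < b) (hK : ContDiffOn ℝ 1 (fun z : ℝ × ℝ => K z.1 z.2) (OmegaPlus b))
    (pde : ∀ x ∈ Ioo 0 b, ∀ s ∈ Ioo (-1 : ℝ) 1, BL (deriv (fun y => K y (x * s)) x)
      + BR (deriv (fun y => K x y) (x * s)) = - QL x (K x (x * s)))
    (g1 : ∀ x ∈ Ioo 0 b, BL (K x x) - BR (K x x) = - qv x)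
    (g2 : ∀ x ∈ Ioo 0 b, BL (K x (-x)) + BR (K x (-x)) = 0)
    (n : ℕ) (r : Polynomial ℝ) {x : ℝ} (hx : x ∈ Ioo 0 b) :
    ∃ G', HasDerivAt (fun y => y ^ (n + 1) • Iop K r y) G' x ∧
      BL G' + QL x (x ^ (n + 1) • Iop K r x) =
        x ^ n • (BL (Iop K (C ((n : ℝ) + 1) * r - derivative (X * r)) x)
          + BR (Iop K (derivative r) x) - r.eval 1 • qv x) := by
  have : CompleteSpace E := FiniteDimensional.complete ℝ E
  have hxc : x ∈ Icc 0 b := ⟨hx.1.le, hx.2.le⟩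
  have hI := I_deriv hb hK r hx
  have i1 := ii_of (D_cont_s hb hK hxc (1, 0)) r
  have i2 := ii_of (D_cont_s hb hK hxc (0, 1)) (X * r)
  have i3 := ii_of (D_cont_s hb hK hxc (0, 1)) r
  have i4 := ii_of (k_cont_s hK hxc) r
  have p2 := I_parts hb hK (X * r) hx
  have p3 := I_parts hb hK r hx
  have hsplit : (∫ s in (-1 : ℝ)..1, r.eval s • Dk b K (x, x * s) (1, s)) =
      (∫ s in (-1 : ℝ)..1, r.eval s • Dk b K (x, x * s) (1, 0)) +
      ∫ s in (-1 : ℝ)..1, (X * r).eval s • Dk b K (x, x * s) (0, 1) := by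
    rw [← intervalIntegral.integral_add i1 i2]
    refine intervalIntegral.integral_congr fun s _ => ?_
    have : ((1 : ℝ), s) = (1, 0) + s • ((0 : ℝ), (1 : ℝ)) := by simp
    simp only [this, map_add, map_smul, eval_mul, eval_X, smul_add, smul_smul]
    rw [mul_comm (eval s r) s]
  have h1 : BL (∫ s in (-1 : ℝ)..1, r.eval s • Dk b K (x, x * s) (1, 0)) +
      BR (∫ s in (-1 : ℝ)..1, r.eval s • Dk b K (x, x * s) (0, 1)) = - QL x (Iop K r x) := by
    have e1 := ContinuousLinearMap.intervalIntegral_comp_comm (LinearMap.toContinuousLinearMap BL) i1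
    have e3 := ContinuousLinearMap.intervalIntegral_comp_comm (LinearMap.toContinuousLinearMap BR) i3
    have e4 := ContinuousLinearMap.intervalIntegral_comp_comm
      (LinearMap.toContinuousLinearMap (QL x)) i4
    have j1 : IntervalIntegrable _ volume (-1) 1 :=
      ⟨(LinearMap.toContinuousLinearMap BL).integrable_comp i1.1,
        (LinearMap.toContinuousLinearMap BL).integrable_comp i1.2⟩
    have j3 : IntervalIntegrable _ volume (-1) 1 :=
      ⟨(LinearMap.toContinuousLinearMap BR).integrable_comp i3.1,
        (LinearMap.toContinuousLinearMap BR).integrable_comp i3.2⟩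
    simp only [LinearMap.coe_toContinuousLinearMap'] at e1 e3 e4 j1 j3
    rw [Iop, ← e1, ← e3, ← e4, ← intervalIntegral.integral_add j1 j3,
      ← intervalIntegral.integral_neg]
    refine intervalIntegral.integral_congr_ae ?_
    filter_upwards [ae_ioo] with s hs h
    have := pde x hx s (hs h)
    rw [Dk_x hK hx (hs h), Dk_t hK hx (hs h)] at this
    simp only [map_smul]
    rw [← smul_add, this, smul_neg]
  rw [hsplit] at hI
  refine ⟨_, (hasDerivAt_pow (n + 1) x).smul hI, ?_⟩
  rw [I_comb hK hxc]
  set J1 := ∫ s in (-1 : ℝ)..1, r.eval s • Dk b K (x, x * s) (1, 0)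
  set J2 := ∫ s in (-1 : ℝ)..1, (X * r).eval s • Dk b K (x, x * s) (0, 1)
  set J3 := ∫ s in (-1 : ℝ)..1, r.eval s • Dk b K (x, x * s) (0, 1)
  have q2 := congrArg BL p2
  have q3 := congrArg BR p3
  have g1 := g1 x hx
  have g2 := g2 x hx
  simp only [map_smul, map_add, map_sub, eval_mul, eval_X, one_mul, Nat.add_sub_cancel, neg_one_mul]
    at q2 q3 ⊢
  push_cast
  have h1' : BL J1 = - QL x (Iop K r x) - BR J3 := by rw [← h1]; abel
  have g1' : BL (K x x) = BR (K x x) - qv x := by rw [sub_eq_add_neg, ← g1]; abel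
  have g2' : BL (K x (-x)) = - BR (K x (-x)) := eq_neg_of_add_eq_zero_left g2
  rw [g1', g2'] at q2
  have q2' := congrArg (fun v => x ^ n • v) q2
  have q3' := congrArg (fun v => x ^ n • v) q3
  beta_reduce at q2' q3'
  rw [h1']
  linear_combination (norm := module) q2' - q3'

end kern

theorem theta_eq (K : ℝ → ℝ → M2) (n : ℕ) (x : ℝ) :
    theta K (n : ℤ) x = ((2 * (n : ℝ) + 1) / 2) • (x ^ (n + 1) • Iop K (legendreP n) x) := by
  have hn : ¬ ((n : ℤ) = -1) := by omega
  rw [theta, if_neg hn, Int.toNat_natCast, Kcoef, smul_comm]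
  congr 1
  by_cases hx : x = 0
  · subst hx; simp
  · rw [pow_succ, mul_smul]
    congr 1
    have := intervalIntegral.smul_integral_comp_mul_left (a := -1) (b := 1)
      (fun t => (legendreP n).eval (t / x) • K x t) x
    rw [mul_neg, mul_one] at this
    rw [← this, Iop]
    simp only [mul_div_cancel_left₀ _ hx]

theorem Iop_C_mul (K : ℝ → ℝ → M2) (c : ℝ) (r : Polynomial ℝ) (x : ℝ) :
    Iop K (C c * r) x = c • Iop K r x := by
  simp only [Iop, eval_mul, eval_C, mul_smul]
  rw [intervalIntegral.integral_smul]

theorem Sop_congr (U : ℝ → M2) {H₁ H₂ : ℝ → M2} {x : ℝ} (hx : 0 ≤ x)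
    (h : ∀ t ∈ Icc 0 x, H₁ t = H₂ t) : Sop U H₁ x = Sop U H₂ x := by
  rw [Sop, Sop]
  congr 1
  refine intervalIntegral.integral_congr fun t ht => ?_
  rw [uIcc_of_le hx] at ht
  simp only [h t ht]

theorem main_mat {b : ℝ} (hb : 0 < b) {p q : ℝ → ℂ} {K : ℝ → ℝ → M2}
    (hK : ContDiffOn ℝ 1 (fun z : ℝ × ℝ => K z.1 z.2) (OmegaPlus b))
    (hker : IsTransKernel b (diracPot p q) K) (n : ℕ) (r : Polynomial ℝ) {x : ℝ}
    (hx : x ∈ Ioo 0 b) :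
    ∃ G', HasDerivAt (fun y => y ^ (n + 1) • Iop K r y) G' x ∧
      Bmat * G' + diracPot p q x * (x ^ (n + 1) • Iop K r x) =
        x ^ n • (Bmat * (Iop K (C ((n : ℝ) + 1) * r - derivative (X * r)) x)
          + (Iop K (derivative r) x) * Bmat - r.eval 1 • diracPot p q x) := by
  exact main_gen (E := M2) (LinearMap.mulLeft ℝ Bmat) (LinearMap.mulRight ℝ Bmat)
    (fun x => LinearMap.mulLeft ℝ (diracPot p q x)) (diracPot p q) hb hK
    (fun x hx s hs => hker.1 x (x * s) (mem_of_mem_nhds (Omega_nhds hx hs)))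
    (fun x hx => hker.2.1 x ⟨hx.1.le, hx.2.le⟩)
    (fun x hx => hker.2.2 x ⟨hx.1.le, hx.2.le⟩) n r hx

theorem solve_mom {b : ℝ} (hb : 0 < b) {p q : ℝ → ℂ} {K : ℝ → ℝ → M2}
    (hK : ContDiffOn ℝ 1 (fun z : ℝ × ℝ => K z.1 z.2) (OmegaPlus b))
    (hker : IsTransKernel b (diracPot p q) K)
    {U U' : ℝ → M2} (hU0 : U 0 = 1)
    (hUd : ∀ x ∈ Set.Icc 0 b, HasDerivWithinAt U (U' x) (Set.Icc 0 b) x)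
    (hUode : ∀ x ∈ Set.Icc 0 b, Bmat * U' x + diracPot p q x * U x = 0)
    (c : ℝ) (n : ℕ) (r r₁ r₂ : Polynomial ℝ) (hr : r.eval 1 = 0)
    (h1 : C ((n : ℝ) + 1) * r - derivative (X * r) = r₁) (h2 : derivative r = r₂)
    {x : ℝ} (hx : x ∈ Icc 0 b) :
    c • (x ^ (n + 1) • Iop K r x) =
      Sop U (fun y => c • (y ^ n • (Bmat * Iop K r₁ y + Iop K r₂ y * Bmat))) x := by
  have hc : ∀ r, ContinuousOn (fun y => Iop K r y) (Icc 0 b) := fun r => I_cont (E := M2) hK r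
  have hp : ∀ k : ℕ, ContinuousOn (fun y : ℝ => y ^ k) (Icc 0 b) := fun k => continuousOn_pow k
  have hcc : ContinuousOn (fun _ : ℝ => c) (Icc 0 b) := continuousOn_const
  refine ode_solve hU0 hUd hUode (G := fun x => c • (x ^ (n + 1) • Iop K r x)) ?_ ?_ ?_ ?_ hx
  · exact hcc.smul ((hp _).smul (hc r))
  · simp
  · exact hcc.smul ((hp _).smul
      ((continuousOn_const.mul (hc r₁)).add ((hc r₂).mul continuousOn_const)))
  · intro y hy
    obtain ⟨G', hG', hE⟩ := main_mat hb hK hker n r hy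
    refine ⟨c • G', hG'.const_smul c, ?_⟩
    rw [hr, h1, h2, zero_smul, sub_zero] at hE
    rw [mul_smul_comm, mul_smul_comm, ← smul_add, hE]

theorem theta_zero {b : ℝ} (hb : 0 < b) {p q : ℝ → ℂ} {K : ℝ → ℝ → M2}
    (hK : ContDiffOn ℝ 1 (fun z : ℝ × ℝ => K z.1 z.2) (OmegaPlus b))
    (hker : IsTransKernel b (diracPot p q) K)
    {U U' : ℝ → M2} (hU0 : U 0 = 1)
    (hUd : ∀ x ∈ Set.Icc 0 b, HasDerivWithinAt U (U' x) (Set.Icc 0 b) x)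
    (hUode : ∀ x ∈ Set.Icc 0 b, Bmat * U' x + diracPot p q x * U x = 0)
    {x : ℝ} (hx : x ∈ Icc 0 b) : x ^ (0 + 1) • Iop K 1 x = U x - 1 := by
  have hUc : ContinuousOn U (Icc 0 b) := fun y hy => (hUd y hy).continuousWithinAt
  have := ode_solve hU0 hUd hUode (G := fun x => x ^ (0 + 1) • Iop K 1 x - (U x - 1))
    (H := fun _ => 0) ?_ ?_ continuousOn_const ?_ hx
  · simp only [Sop, mul_zero, intervalIntegral.integral_zero] at this
    exact sub_eq_zero.1 this
  · exact ((continuousOn_pow _).smul (I_cont (E := M2) hK 1)).sub (hUc.sub continuousOn_const)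
  · simp [hU0]
  · intro y hy
    have hyc : y ∈ Icc 0 b := ⟨hy.1.le, hy.2.le⟩
    obtain ⟨G', hG', hE⟩ := main_mat hb hK hker 0 1 hy
    refine ⟨G' - U' y, hG'.sub
      (((hUd y hyc).hasDerivAt (Icc_mem_nhds hy.1 hy.2)).sub_const 1), ?_⟩
    have hu := hUode y hyc
    have z : Iop K 0 y = 0 := by simp [Iop]
    simp [z] at hE
    have e : Bmat * (G' - U' y) + diracPot p q y * (y ^ (0 + 1) • Iop K 1 y - (U y - 1)) =
      (Bmat * G' + y • (diracPot p q y * Iop K 1 y)) -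
        (Bmat * U' y + diracPot p q y * U y) + diracPot p q y := by
      rw [zero_add, pow_one, mul_sub, mul_sub, mul_sub, mul_smul_comm, mul_one]; abel
    rw [e, hE, hu]; simp

theorem statement8 (b : ℝ) (hb : 0 < b) (p q : ℝ → ℂ)
    (hQ : ContDiffOn ℝ 1 (diracPot p q) (Set.Icc 0 b))
    (K : ℝ → ℝ → M2)
    (hK : ContDiffOn ℝ 1 (fun z : ℝ × ℝ => K z.1 z.2) (OmegaPlus b))
    (hker : IsTransKernel b (diracPot p q) K)
    (U U' : ℝ → M2) (hU0 : U 0 = 1)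
    (hUd : ∀ x ∈ Set.Icc 0 b, HasDerivWithinAt U (U' x) (Set.Icc 0 b) x)
    (hUode : ∀ x ∈ Set.Icc 0 b, Bmat * U' x + diracPot p q x * U x = 0) :
    (∀ x ∈ Set.Icc 0 b, theta K 0 x = (2 : ℝ)⁻¹ • (U x - 1)) ∧
    (∀ x ∈ Set.Ioc 0 b, theta K (-1) x = -((2 * x)⁻¹ • (U x - 1))) ∧
    (∀ n : ℕ, 1 ≤ n → ∀ x ∈ Set.Icc 0 b,
      theta K (n : ℤ) x = ((2 * (n : ℝ) + 1) / (2 * (n : ℝ) - 3)) •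
        (x ^ 2 • theta K ((n : ℤ) - 2) x +
          Sop U (fun t => (-((2 * (n : ℝ) - 1) * t)) • (Bmat * theta K ((n : ℤ) - 2) t)
            + (2 * (n : ℝ) - 3) • (theta K ((n : ℤ) - 1) t * Bmat)) x)) := by
  have t0 : ∀ x, theta K 0 x = (2 : ℝ)⁻¹ • (x ^ (0 + 1) • Iop K 1 x) := by
    intro x
    have := theta_eq K 0 x
    rw [leg_zero] at this
    simpa using this
  have tm : ∀ x, theta K (-1) x = -(x⁻¹ • theta K 0 x) := by
    intro x
    simp [theta]
  have hz : ∀ x ∈ Set.Icc 0 b, theta K 0 x = (2 : ℝ)⁻¹ • (U x - 1) := by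
    intro x hx
    rw [t0, theta_zero hb hK hker hU0 hUd hUode hx]
  refine ⟨hz, ?_, ?_⟩
  · intro x hx
    rw [tm, hz x ⟨hx.1.le, hx.2⟩, smul_smul, mul_inv, mul_comm]
  · intro n hn x hx
    obtain ⟨m, rfl⟩ : ∃ m, n = m + 1 := ⟨n - 1, by omega⟩
    rcases m with _ | m
    · have e1 : (((0 + 1 : ℕ) : ℤ) - 2) = -1 := by norm_num
      have e2 : (((0 + 1 : ℕ) : ℤ) - 1) = 0 := by norm_num
      have tt : ∀ t : ℝ, t • theta K (-1) t = - theta K 0 t := by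
        intro t
        by_cases ht : t = 0
        · subst ht; simp [t0]
        · rw [tm, smul_neg, smul_smul, mul_inv_cancel₀ ht, one_smul]
      have key := solve_mom hb hK hker hU0 hUd hUode (-(1 / 2)) 1 (X - 1) (C (-1) * 1) 1
        (by simp) (by
          simp only [derivative_mul, derivative_X, derivative_sub, derivative_one, Nat.cast_one,
            C_add, C_neg, C_1]
          ring) (by simp) hx
      have hS : Sop U (fun t => (-((2 * ((0 + 1 : ℕ) : ℝ) - 1) * t)) •
            (Bmat * theta K (((0 + 1 : ℕ) : ℤ) - 2) t)
            + (2 * ((0 + 1 : ℕ) : ℝ) - 3) • (theta K (((0 + 1 : ℕ) : ℤ) - 1) t * Bmat)) x =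
          (-(1 / 2) : ℝ) • (x ^ (1 + 1) • Iop K (X - 1) x) := by
        rw [key]
        refine Sop_congr U hx.1 fun t ht => ?_
        rw [e1, e2, Iop_C_mul]
        have : (-((2 * ((0 + 1 : ℕ) : ℝ) - 1) * t)) • (Bmat * theta K (-1) t) =
            Bmat * theta K 0 t := by
          have h : (-((2 * ((0 + 1 : ℕ) : ℝ) - 1) * t)) = -t := by push_cast; ring
          rw [h, neg_smul, ← mul_smul_comm, tt]; simp
        rw [this, t0]
        simp only [mul_smul_comm, smul_mul_assoc]
        push_cast
        module
      rw [hS, e1, theta_eq, leg_one, pow_two, mul_smul x x (theta K (-1) x), tt, t0]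
      have hI : Iop K (X - 1) x = Iop K X x - Iop K 1 x := by
        have := I_comb (E := M2) hK hx 1 X 1
        rwa [C_1, one_mul, one_smul] at this
      rw [hI]
      push_cast
      match_scalars <;> ring
    · have e1 : (((m + 1 + 1 : ℕ) : ℤ) - 2) = (m : ℕ) := by push_cast; ring
      have e2 : (((m + 1 + 1 : ℕ) : ℤ) - 1) = (m + 1 : ℕ) := by push_cast; ring
      have key := solve_mom hb hK hker hU0 hUd hUode ((2 * (m : ℝ) + 1) / 2) (m + 2)
        (legendreP (m + 2) - legendreP m) (C (-(2 * (m : ℝ) + 3)) * legendreP m)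
        (C (2 * (m : ℝ) + 3) * legendreP (m + 1))
        (by simp [leg_at_one]) (by
          have := leg_c m
          rw [derivative_mul, derivative_X]
          rw [C_neg]
          push_cast
          simp only [C_add, C_1] at this ⊢
          linear_combination this) (by rw [derivative_sub, leg_b]; ring) hx
      have hS : Sop U (fun t => (-((2 * ((m + 1 + 1 : ℕ) : ℝ) - 1) * t)) •
            (Bmat * theta K (((m + 1 + 1 : ℕ) : ℤ) - 2) t)
            + (2 * ((m + 1 + 1 : ℕ) : ℝ) - 3) • (theta K (((m + 1 + 1 : ℕ) : ℤ) - 1) t * Bmat)) x =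
          ((2 * (m : ℝ) + 1) / 2) •
            (x ^ (m + 2 + 1) • Iop K (legendreP (m + 2) - legendreP m) x) := by
        rw [key]
        refine Sop_congr U hx.1 fun t ht => ?_
        rw [e1, e2, Iop_C_mul, Iop_C_mul, theta_eq, theta_eq]
        simp only [mul_smul_comm, smul_mul_assoc]
        push_cast
        match_scalars <;> ring
      rw [hS, e1, theta_eq, theta_eq]
      have hI : Iop K (legendreP (m + 2) - legendreP m) x =
          Iop K (legendreP (m + 2)) x - Iop K (legendreP m) x := by
        have := I_comb (E := M2) hK hx 1 (legendreP (m + 2)) (legendreP m)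
        rwa [C_1, one_mul, one_smul] at this
      rw [hI]
      have h21 : 2 * (m : ℝ) + 1 ≠ 0 := by positivity
      have h3 : 2 * ((m : ℝ) + 1 + 1) - 3 = 2 * m + 1 := by ring
      push_cast
      rw [h3]
      match_scalars <;> field_simp <;> ring

end
end
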